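/- A bipartite state ρ_AB has zero discord if and only if there is a complete set of orthogonal projectors {P_j = I_A ⊗ |λ_j⟩⟨λ_j|} built from an eigenbasis of ρ_B such that ρ_AB = Σ_j P_j ρ_AB P_j, i.e. ρ_AB is block-diagonal in a marginal eigenbasis of B. -/

import Mathlib

open Matrix Kronecker BigOperators ComplexOrder

noncomputable section

/-- von Neumann entropy of a (Hermitian) matrix; 0 if not Hermitian. -/
def vNEntropy {n : Type} [Fintype n] [DecidableEq n] (ρ : Matrix n n ℂ) : ℝ :=
  if h : ρ.IsHermitian then ∑ i, Real.negMulLog (h.eigenvalues i) else 0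

/-- Shannon entropy of a finitely supported probability vector. -/
def shannonEntropy {ι : Type} [Fintype ι] (p : ι → ℝ) : ℝ := ∑ i, Real.negMulLog (p i)

/-- Density operator predicate. -/
def IsDensity {n : Type} [Fintype n] [DecidableEq n] (ρ : Matrix n n ℂ) : Prop :=
  ρ.PosSemidef ∧ ρ.trace = 1

/-- |v⟩⟨w| -/
def ketbra {n : Type} (v w : n → ℂ) : Matrix n n ℂ := fun i j => v i * star (w j)

/-- Orthonormal family. -/
def OrthoFam {ι n : Type} [Fintype n] [DecidableEq ι] (v : ι → n → ℂ) : Prop :=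
  ∀ j k, (∑ i, star (v j i) * v k i) = if j = k then 1 else 0

/-- Partial trace over the first (A) factor. -/
def ptrA {dA dB : Type} [Fintype dA] (ρ : Matrix (dA × dB) (dA × dB) ℂ) : Matrix dB dB ℂ :=
  fun b b' => ∑ a, ρ (a, b) (a, b')

/-- Partial trace over the second (B) factor. -/
def ptrB {dA dB : Type} [Fintype dB] (ρ : Matrix (dA × dB) (dA × dB) ℂ) : Matrix dA dA ℂ :=
  fun a a' => ∑ b, ρ (a, b) (a', b)

/-- Outcome probability for POVM element E on B. -/
def pOf {dA dB : Type} [Fintype dA] [Fintype dB] [DecidableEq dA]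
    (ρ : Matrix (dA × dB) (dA × dB) ℂ) (E : Matrix dB dB ℂ) : ℝ :=
  (((1 : Matrix dA dA ℂ) ⊗ₖ E * ρ).trace).re

/-- Conditional state of A given POVM element E on B. -/
def condState {dA dB : Type} [Fintype dA] [Fintype dB] [DecidableEq dA] [DecidableEq dB]
    (ρ : Matrix (dA × dB) (dA × dB) ℂ) (E : Matrix dB dB ℂ) : Matrix dA dA ℂ :=
  ((pOf ρ E : ℂ))⁻¹ • ptrB ((1 : Matrix dA dA ℂ) ⊗ₖ E * ρ)

/-- Set of measured conditional entropies over rank-1 POVMs on B. -/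
def measuredCondEntropies {dA dB : Type} [Fintype dA] [Fintype dB] [DecidableEq dA] [DecidableEq dB]
    (ρ : Matrix (dA × dB) (dA × dB) ℂ) : Set ℝ :=
  { x | ∃ (m : ℕ) (M : Fin m → Matrix dB dB ℂ),
      (∀ i, (M i).PosSemidef) ∧ (∀ i, (M i).rank ≤ 1) ∧ (∑ i, M i = 1) ∧
      x = ∑ i, pOf ρ (M i) * vNEntropy (condState ρ (M i)) }

/-- Quantum discord with measurements on B. -/
def discord {dA dB : Type} [Fintype dA] [Fintype dB] [DecidableEq dA] [DecidableEq dB]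
    (ρ : Matrix (dA × dB) (dA × dB) ℂ) : ℝ :=
  vNEntropy (ptrA ρ) - vNEntropy ρ + sInf (measuredCondEntropies ρ)

/-- The B-contraction ⟨e_j| ρ |e_k⟩ as operator on A. -/
def bContract {dA dB : Type} [Fintype dB]
    (ρ : Matrix (dA × dB) (dA × dB) ℂ) (u v : dB → ℂ) : Matrix dA dA ℂ :=
  fun a a' => ∑ b, ∑ b', star (u b) * ρ (a, b) (a', b') * v b'

/-- Extended state ρ'_ABC from measuring B in basis e, recorded in C with family f. -/
def extState {dA dB dC : Type} [Fintype dA] [Fintype dB] [Fintype dC]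
    (ρ : Matrix (dA × dB) (dA × dB) ℂ) (e : dB → dB → ℂ) (f : dB → dC → ℂ) :
    Matrix (dA × dB × dC) (dA × dB × dC) ℂ :=
  fun x y => ∑ j, ∑ k,
    bContract ρ (e j) (e k) x.1 y.1 * e j x.2.1 * star (e k y.2.1) * f j x.2.2 * star (f k y.2.2)

/-- Partial trace over C for a tripartite A ⊗ B ⊗ C matrix. -/
def ptrC3 {dA dB dC : Type} [Fintype dC]
    (ρ : Matrix (dA × dB × dC) (dA × dB × dC) ℂ) : Matrix (dA × dB) (dA × dB) ℂ :=
  fun x y => ∑ c, ρ (x.1, x.2, c) (y.1, y.2, c)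

/-- Partial trace over A for a tripartite matrix. -/
def ptrA3 {dA dB dC : Type} [Fintype dA]
    (ρ : Matrix (dA × dB × dC) (dA × dB × dC) ℂ) : Matrix (dB × dC) (dB × dC) ℂ :=
  fun x y => ∑ a, ρ (a, x.1, x.2) (a, y.1, y.2)

/-- Partial trace over both A and C. -/
def ptrAC3 {dA dB dC : Type} [Fintype dA] [Fintype dC]
    (ρ : Matrix (dA × dB × dC) (dA × dB × dC) ℂ) : Matrix dB dB ℂ :=
  fun b b' => ∑ a, ∑ c, ρ (a, b, c) (a, b', c)

/-- A combination of logarithms of total weight zero whose derivative is nonnegative is nonpositive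
at the origin, and its derivative is controlled by that value somewhere in `[2, 3]`. -/
lemma log_combination_bound {ι : Type*} [Fintype ι] (c x : ι → ℝ)
    (hx : ∀ k, c k ≠ 0 → 0 < x k) (hc : ∑ k, c k = 0)
    (hd : ∀ t : ℝ, 0 < t → 0 ≤ ∑ k, c k / (x k + t)) :
    0 ≤ -∑ k, c k * Real.log (x k) ∧
      ∃ ξ ∈ Set.Icc (2 : ℝ) 3, ∑ k, c k / (x k + ξ) ≤ -∑ k, c k * Real.log (x k) := by
  set f : ℝ → ℝ := fun t => ∑ k, c k * Real.log (x k + t) with hf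
  have hder : ∀ t : ℝ, 0 ≤ t → HasDerivAt f (∑ k, c k / (x k + t)) t := by
    intro t ht
    refine HasDerivAt.fun_sum fun k _ => ?_
    by_cases hk : c k = 0
    · simpa [hk] using hasDerivAt_const t (0 : ℝ)
    · have hpos : x k + t ≠ 0 := by linarith [hx k hk]
      have := (((hasDerivAt_id t).const_add (x k)).log hpos).const_mul (c k)
      simpa [div_eq_mul_inv] using this
  have hmono : MonotoneOn f (Set.Ici 0) := by
    refine monotoneOn_of_deriv_nonneg (convex_Ici 0)
      (fun t ht => (hder t ht).continuousAt.continuousWithinAt)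
      (fun t ht => ?_) (fun t ht => ?_)
    · rw [interior_Ici] at ht
      exact (hder t (le_of_lt ht)).differentiableAt.differentiableWithinAt
    · rw [interior_Ici] at ht
      rw [(hder t (le_of_lt ht)).deriv]
      exact hd t ht
  have hlim : Filter.Tendsto f Filter.atTop (nhds 0) := by
    have h1 : Filter.Tendsto (fun t : ℝ => ∑ k, c k * (Real.log (t + x k) - Real.log t))
        Filter.atTop (nhds (∑ k, c k * 0)) :=
      tendsto_finsetSum _ fun k _ => (Real.tendsto_log_comp_add_sub_log (x k)).const_mul (c k)
    have h2 : (fun t : ℝ => ∑ k, c k * (Real.log (t + x k) - Real.log t)) = f := by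
      funext t
      simp only [mul_sub, Finset.sum_sub_distrib, ← Finset.sum_mul, hc, zero_mul, sub_zero, hf]
      exact Finset.sum_congr rfl fun k _ => by rw [add_comm]
    rw [h2] at h1
    simpa using h1
  have hle : ∀ t : ℝ, 0 ≤ t → f t ≤ 0 := fun t ht =>
    ge_of_tendsto hlim ((Filter.eventually_ge_atTop t).mono fun y hy => hmono ht (ht.trans hy) hy)
  have hzero : f 0 = ∑ k, c k * Real.log (x k) := by simp [hf]
  refine ⟨by linarith [hle 0 le_rfl], ?_⟩
  obtain ⟨ξ, hξ, hslope⟩ := exists_hasDerivAt_eq_slope f (fun t => ∑ k, c k / (x k + t))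
    (show (2 : ℝ) < 3 by norm_num)
    (fun t ht => (hder t (by linarith [ht.1])).continuousAt.continuousWithinAt)
    (fun t ht => hder t (by linarith [ht.1]))
  refine ⟨ξ, ⟨hξ.1.le, hξ.2.le⟩, ?_⟩
  have h2 : f 0 ≤ f 2 := hmono (by simp) (by simp) (by norm_num)
  have h3 := hle 3 (by norm_num)
  rw [hslope, ← hzero]
  norm_num
  linarith

lemma sum_norm_sub_sq {ι : Type*} (s : Finset ι) (p q : ι → ℂ) :
    ∑ i ∈ s, ‖p i - q i‖ ^ 2 =
      ∑ i ∈ s, ‖p i‖ ^ 2 - 2 * (∑ i ∈ s, star (p i) * q i).re + ∑ i ∈ s, ‖q i‖ ^ 2 := by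
  rw [Complex.re_sum, Finset.mul_sum, ← Finset.sum_sub_distrib, ← Finset.sum_add_distrib]
  refine Finset.sum_congr rfl fun i _ => ?_
  simp only [Complex.sq_norm, Complex.normSq_apply, Complex.sub_re, Complex.sub_im,
    Complex.mul_re, Complex.star_def, Complex.conj_re, Complex.conj_im]
  ring

lemma ofReal_norm_sq (z : ℂ) : ((‖z‖ ^ 2 : ℝ) : ℂ) = star z * z := by
  rw [Complex.star_def, Complex.conj_mul', Complex.ofReal_pow]

lemma norm_sub_sq_le_two_mul (x y : ℂ) : ‖x - y‖ ^ 2 ≤ 2 * ‖x‖ ^ 2 + 2 * ‖y‖ ^ 2 := by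
  have h := norm_sub_le x y
  nlinarith [sq_nonneg (‖x‖ - ‖y‖), norm_nonneg (x - y), norm_nonneg x, norm_nonneg y]

section Contraction

variable {A B X : Type*} [Fintype X]

/-- Contraction of an `A × X` array with the conjugate of `L` over `X`. -/
def contractX (L : A → B → X → ℂ) (η : A → X → ℂ) (a a' : A) (b : B) : ℂ :=
  ∑ x, η a x * star (L a' b x)

/-- Contraction of an `A × X` array with the conjugate of `L` over `A` and `X`. -/
def contractAX [Fintype A] (L : A → B → X → ℂ) (η : A → X → ℂ) (b : B) : ℂ :=
  ∑ a, contractX L η a a b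

lemma contractX_sub (L : A → B → X → ℂ) (η ζ : A → X → ℂ) (a a' : A) (b : B) :
    contractX L (fun a x => η a x - ζ a x) a a' b = contractX L η a a' b - contractX L ζ a a' b := by
  simp only [contractX, sub_mul, Finset.sum_sub_distrib]

variable [Fintype A] [Fintype B] [DecidableEq X]

lemma sum_norm_contractX_sq (L : A → B → X → ℂ) (r : X → ℝ)
    (hL : ∀ x x', ∑ a, ∑ b, star (L a b x) * L a b x' = if x = x' then (r x : ℂ) else 0)
    (η : A → X → ℂ) (a : A) :
    ∑ a', ∑ b, ‖contractX L η a a' b‖ ^ 2 = ∑ x, ‖η a x‖ ^ 2 * r x := by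
  apply Complex.ofReal_injective
  push_cast
  have h1 : ∀ a' b, ((‖contractX L η a a' b‖ : ℂ)) ^ 2 =
      ∑ x, ∑ x', η a x * star (η a x') * (star (L a' b x) * L a' b x') := by
    intro a' b
    have := ofReal_norm_sq (contractX L η a a' b)
    push_cast at this
    rw [this, contractX, star_sum, mul_comm, Finset.sum_mul_sum]
    refine Finset.sum_congr rfl fun x _ => Finset.sum_congr rfl fun x' _ => ?_
    simp only [star_mul', star_star]
    ring
  calc ∑ a', ∑ b, ((‖contractX L η a a' b‖ : ℂ)) ^ 2
      = ∑ x, ∑ x', η a x * star (η a x') * ∑ a', ∑ b, (star (L a' b x) * L a' b x') := by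
        simp only [h1, Finset.mul_sum]
        rw [Finset.sum_congr rfl fun a' _ => Finset.sum_comm, Finset.sum_comm]
        refine Finset.sum_congr rfl fun x _ => ?_
        rw [Finset.sum_congr rfl fun a' _ => Finset.sum_comm, Finset.sum_comm]
    _ = ∑ x, ((‖η a x‖ : ℂ)) ^ 2 * r x := by
        refine Finset.sum_congr rfl fun x _ => ?_
        have := ofReal_norm_sq (η a x)
        push_cast at this
        simp only [hL, mul_ite, mul_zero, Finset.sum_ite_eq, Finset.mem_univ, if_true, this]
        ring

/-- Resolvent comparison: if `K = (R + t) U` for `R` the Gram operator of the contraction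
`contractAX L`, the gap between the resolvents of `R` and of `s⁻¹ ⊗ r` at `K` is nonnegative and
controls the failure of `contractX L U` to factorize. -/
lemma resolvent_gap [DecidableEq A] (L : A → B → X → ℂ) (r : X → ℝ) (s : A → ℝ) (t : ℝ)
    (K U : A → X → ℂ)
    (hL : ∀ x x', ∑ a, ∑ b, star (L a b x) * L a b x' = if x = x' then (r x : ℂ) else 0)
    (hr : ∀ x, 0 ≤ r x) (hr1 : ∀ x, r x ≤ 1) (hs : ∀ a, 0 ≤ s a) (hs1 : ∑ a, s a ≤ 1)
    (ht : 0 < t) (hK : ∀ a x, s a = 0 → K a x = 0)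
    (hKU : ∀ η : A → X → ℂ, ∑ a, ∑ x, star (η a x) * K a x =
      ∑ b, star (contractAX L η b) * contractAX L U b + t * ∑ a, ∑ x, star (η a x) * U a x) :
    0 ≤ (∑ a, ∑ x, star (U a x) * K a x).re - ∑ a, ∑ x, ‖K a x‖ ^ 2 * (s a / (r x + t * s a)) ∧
    (1 ≤ t → ∑ a, ∑ a', ∑ b,
        ‖contractX L U a a' b - (if a = a' then (s a : ℂ) * contractAX L U b else 0)‖ ^ 2 ≤
      4 * ((∑ a, ∑ x, star (U a x) * K a x).re -
        ∑ a, ∑ x, ‖K a x‖ ^ 2 * (s a / (r x + t * s a)))) := by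
  set z : A → X → ℂ := fun a x => K a x / ((r x + t * s a : ℝ) : ℂ) with hz
  set w : A → X → ℂ := fun a x => s a * z a x with hw
  set y : B → ℂ := contractAX L w with hy
  set γ : ℝ := ∑ a, s a * ∑ x, ‖z a x‖ ^ 2 * r x with hγ
  set FG : ℝ := ∑ a, ∑ x, ‖K a x‖ ^ 2 * (s a / (r x + t * s a)) with hFG
  have hKz : ∀ a x, K a x = z a x * ((r x + t * s a : ℝ) : ℂ) := by
    intro a x
    by_cases h : s a = 0
    · simp [hz, hK a x h]
    · have : 0 < r x + t * s a :=
        add_pos_of_nonneg_of_pos (hr x) (mul_pos ht (lt_of_le_of_ne (hs a) (Ne.symm h)))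
      simp only [hz]
      rw [div_mul_cancel₀]
      exact_mod_cast this.ne'
  have hnorm : ∀ a x, ‖K a x‖ ^ 2 = ‖z a x‖ ^ 2 * (r x + t * s a) ^ 2 := by
    intro a x
    rw [hKz a x, norm_mul, mul_pow, Complex.norm_real, Real.norm_eq_abs, sq_abs]
  have hFGγ : FG = γ + t * ∑ a, ∑ x, ‖w a x‖ ^ 2 := by
    simp only [hFG, hγ, Finset.mul_sum, ← Finset.sum_add_distrib]
    refine Finset.sum_congr rfl fun a _ => Finset.sum_congr rfl fun x _ => ?_
    rw [hnorm a x, hw]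
    simp only [norm_mul, mul_pow, Complex.norm_real, Real.norm_eq_abs, sq_abs]
    by_cases h : r x + t * s a = 0
    · have h0 : s a = 0 := by
        have := mul_nonneg ht.le (hs a)
        have h2 : t * s a = 0 := by linarith [hr x]
        exact (mul_eq_zero.mp h2).resolve_left ht.ne'
      simp [h0]
    · field_simp
  have hwK : (∑ a, ∑ x, star (w a x) * K a x).re = FG := by
    have : ∑ a, ∑ x, star (w a x) * K a x = ((FG : ℝ) : ℂ) := by
      rw [hFGγ, hγ]
      push_cast
      simp only [Finset.mul_sum, ← Finset.sum_add_distrib]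
      refine Finset.sum_congr rfl fun a _ => Finset.sum_congr rfl fun x _ => ?_
      have h1 := ofReal_norm_sq (z a x)
      have h2 := ofReal_norm_sq (w a x)
      push_cast at h1 h2
      rw [h1, h2, hKz a x, hw]
      simp only [star_mul', Complex.star_def, Complex.conj_ofReal]
      push_cast
      ring
    rw [this, Complex.ofReal_re]
  have hexpand : (∑ a, ∑ x, star (U a x) * K a x).re - FG =
      (γ - ∑ b, ‖y b‖ ^ 2) + ∑ b, ‖y b - contractAX L U b‖ ^ 2 +
        t * ∑ a, ∑ x, ‖w a x - U a x‖ ^ 2 := by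
    have hU : (∑ a, ∑ x, star (U a x) * K a x).re =
        ∑ b, ‖contractAX L U b‖ ^ 2 + t * ∑ a, ∑ x, ‖U a x‖ ^ 2 := by
      rw [hKU U]
      simp only [← ofReal_norm_sq]
      norm_cast
    have hwU := congrArg Complex.re (hKU w)
    rw [hwK, Complex.add_re, Complex.re_ofReal_mul] at hwU
    rw [sum_norm_sub_sq, hU]
    simp only [sum_norm_sub_sq, Finset.sum_add_distrib, Finset.sum_sub_distrib, ← Finset.mul_sum,
      ← Complex.re_sum]
    linarith
  have hdefect : ∑ a, s a * ∑ a', ∑ b,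
      ‖contractX L z a a' b - (if a = a' then y b else 0)‖ ^ 2 ≤ γ - ∑ b, ‖y b‖ ^ 2 := by
    have hcw : ∀ a a' b, contractX L w a a' b = s a * contractX L z a a' b := by
      intro a a' b
      simp only [contractX, hw, Finset.mul_sum, mul_assoc]
    have hrow : ∀ a, s a * ∑ a', ∑ b,
        ‖contractX L z a a' b - (if a = a' then y b else 0)‖ ^ 2 =
        s a * (∑ x, ‖z a x‖ ^ 2 * r x) - 2 * (∑ b, star (contractX L w a a b) * y b).re +
          s a * ∑ b, ‖y b‖ ^ 2 := by
      intro a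
      rw [← sum_norm_contractX_sq L r hL z a]
      have h1 : ∑ a', (∑ b, star (contractX L z a a' b) * (if a = a' then y b else 0)).re =
          (∑ b, star (contractX L z a a b) * y b).re := by
        rw [Finset.sum_eq_single a]
        · simp
        · intro a' _ hne
          simp [Ne.symm hne]
        · simp
      have h2 : ∑ a', ∑ b, ‖(if a = a' then y b else 0)‖ ^ 2 = ∑ b, ‖y b‖ ^ 2 := by
        rw [Finset.sum_eq_single a]
        · simp
        · intro a' _ hne
          simp [Ne.symm hne]
        · simp
      simp only [sum_norm_sub_sq, Finset.sum_add_distrib, Finset.sum_sub_distrib,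
        ← Finset.mul_sum, h1, h2, hcw]
      have h3 : (∑ b, star (↑(s a) * contractX L z a a b) * y b).re =
          s a * (∑ b, star (contractX L z a a b) * y b).re := by
        rw [← Complex.re_ofReal_mul, Finset.mul_sum]
        congr 1
        refine Finset.sum_congr rfl fun b _ => ?_
        simp only [star_mul', Complex.star_def, Complex.conj_ofReal]
        ring
      rw [h3]
      ring
    have hcross : ∑ a, (∑ b, star (contractX L w a a b) * y b).re = ∑ b, ‖y b‖ ^ 2 := by
      rw [← Complex.re_sum, Finset.sum_comm]
      simp only [← Finset.sum_mul, ← star_sum]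
      have : ∀ b, star (∑ a, contractX L w a a b) * y b = ((‖y b‖ ^ 2 : ℝ) : ℂ) := by
        intro b
        rw [ofReal_norm_sq]
        rfl
      simp only [this]
      norm_cast
    simp only [hrow, Finset.sum_add_distrib, Finset.sum_sub_distrib, ← Finset.mul_sum, hcross,
      ← Finset.sum_mul]
    rw [← hγ]
    have hynn : 0 ≤ ∑ b, ‖y b‖ ^ 2 := Finset.sum_nonneg fun b _ => by positivity
    nlinarith
  have hDnn : 0 ≤ ∑ a, s a * ∑ a', ∑ b,
      ‖contractX L z a a' b - (if a = a' then y b else 0)‖ ^ 2 :=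
    Finset.sum_nonneg fun a _ => mul_nonneg (hs a)
      (Finset.sum_nonneg fun _ _ => Finset.sum_nonneg fun _ _ => by positivity)
  have hSnn : 0 ≤ ∑ b, ‖y b - contractAX L U b‖ ^ 2 := Finset.sum_nonneg fun b _ => by positivity
  have hTnn : 0 ≤ ∑ a, ∑ x, ‖w a x - U a x‖ ^ 2 :=
    Finset.sum_nonneg fun _ _ => Finset.sum_nonneg fun _ _ => by positivity
  have hs_le : ∀ a, s a ≤ 1 := fun a =>
    (Finset.single_le_sum (fun a _ => hs a) (Finset.mem_univ a)).trans hs1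
  refine ⟨by rw [hexpand]; nlinarith, fun ht1 => ?_⟩
  rw [hexpand]
  set d : A → X → ℂ := fun a x => w a x - U a x with hd
  have hterm : ∀ a a' b,
      ‖contractX L U a a' b - (if a = a' then (s a : ℂ) * contractAX L U b else 0)‖ ^ 2 ≤
      2 * (s a * ‖contractX L z a a' b - (if a = a' then y b else 0)‖ ^ 2) +
      2 * (2 * ‖contractX L d a a' b‖ ^ 2 +
        2 * (if a = a' then s a * ‖y b - contractAX L U b‖ ^ 2 else 0)) := by
    intro a a' b
    have hcw : contractX L w a a' b = s a * contractX L z a a' b := by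
      simp only [contractX, hw, Finset.mul_sum, mul_assoc]
    have heq : contractX L U a a' b - (if a = a' then (s a : ℂ) * contractAX L U b else 0) =
        s a * (contractX L z a a' b - (if a = a' then y b else 0)) -
        (contractX L d a a' b - (if a = a' then (s a : ℂ) * (y b - contractAX L U b) else 0)) := by
      rw [hd, contractX_sub, hcw]
      split_ifs <;> ring
    rw [heq]
    refine (norm_sub_sq_le_two_mul _ _).trans ?_
    have hss : s a ^ 2 ≤ s a := by nlinarith [hs a, hs_le a]
    have h1 : ‖(s a : ℂ) * (contractX L z a a' b - (if a = a' then y b else 0))‖ ^ 2 ≤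
        s a * ‖contractX L z a a' b - (if a = a' then y b else 0)‖ ^ 2 := by
      rw [norm_mul, mul_pow, Complex.norm_real, Real.norm_eq_abs, sq_abs]
      exact mul_le_mul_of_nonneg_right hss (by positivity)
    have h2 : ‖(if a = a' then (s a : ℂ) * (y b - contractAX L U b) else 0)‖ ^ 2 ≤
        if a = a' then s a * ‖y b - contractAX L U b‖ ^ 2 else 0 := by
      split_ifs
      · rw [norm_mul, mul_pow, Complex.norm_real, Real.norm_eq_abs, sq_abs]
        exact mul_le_mul_of_nonneg_right hss (by positivity)
      · simp
    have h3 := norm_sub_sq_le_two_mul (contractX L d a a' b)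
      (if a = a' then (s a : ℂ) * (y b - contractAX L U b) else 0)
    linarith
  have hsum := Finset.sum_le_sum fun a (_ : a ∈ Finset.univ) =>
    Finset.sum_le_sum fun a' (_ : a' ∈ Finset.univ) =>
      Finset.sum_le_sum fun b (_ : b ∈ Finset.univ) => hterm a a' b
  refine hsum.trans ?_
  have hdiag : ∑ a, ∑ a', ∑ b, (if a = a' then s a * ‖y b - contractAX L U b‖ ^ 2 else 0) =
      (∑ a, s a) * ∑ b, ‖y b - contractAX L U b‖ ^ 2 := by
    rw [Finset.sum_mul]
    refine Finset.sum_congr rfl fun a _ => ?_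
    rw [Finset.sum_eq_single a]
    · simp [Finset.mul_sum]
    · intro a' _ hne
      simp [Ne.symm hne]
    · simp
  have hdle : ∑ a, ∑ a', ∑ b, ‖contractX L d a a' b‖ ^ 2 ≤ ∑ a, ∑ x, ‖d a x‖ ^ 2 := by
    simp only [sum_norm_contractX_sq L r hL d]
    refine Finset.sum_le_sum fun a _ => Finset.sum_le_sum fun x _ => ?_
    nlinarith [hr1 x, sq_nonneg ‖d a x‖]
  simp only [Finset.sum_add_distrib, ← Finset.mul_sum, hdiag]
  nlinarith

end Contraction

section Spectral

variable {n : Type} [Fintype n] [DecidableEq n]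

lemma vNEntropy_eq_of_diagonalization {H Q : Matrix n n ℂ} {d : n → ℝ} (hQ : Qᴴ * Q = 1)
    (hH : H = Q * diagonal (fun i => (d i : ℂ)) * Qᴴ) :
    vNEntropy H = ∑ i, Real.negMulLog (d i) := by
  have hHerm : H.IsHermitian := by
    rw [hH, Matrix.IsHermitian, conjTranspose_mul, conjTranspose_mul, conjTranspose_conjTranspose,
      diagonal_conjTranspose, Matrix.mul_assoc]
    congr 3
    funext i
    simp
  have hroots : H.charpoly.roots = Multiset.map (fun i => (d i : ℂ)) Finset.univ.val := by
    rw [hH, charpoly_mul_comm, ← Matrix.mul_assoc, hQ, Matrix.one_mul, charpoly_diagonal,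
      Polynomial.roots_prod]
    · simp
    · simp [Finset.prod_ne_zero_iff, Polynomial.X_sub_C_ne_zero]
  have hmap := congrArg (Multiset.map fun z : ℂ => Real.negMulLog z.re)
    (hHerm.roots_charpoly_eq_eigenvalues.symm.trans hroots)
  rw [Multiset.map_map, Multiset.map_map] at hmap
  rw [vNEntropy, dif_pos hHerm]
  exact congrArg Multiset.sum hmap

lemma Matrix.PosSemidef.exists_diagonalization {H : Matrix n n ℂ} (h : H.PosSemidef) :
    ∃ (Q : Matrix n n ℂ) (d : n → ℝ), Qᴴ * Q = 1 ∧ Q * Qᴴ = 1 ∧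
      H = Q * diagonal (fun i => (d i : ℂ)) * Qᴴ ∧ (∀ i, 0 ≤ d i) := by
  refine ⟨h.1.eigenvectorUnitary, h.1.eigenvalues, ?_, ?_, ?_, h.eigenvalues_nonneg⟩
  · exact Unitary.coe_star_mul_self _
  · exact Unitary.coe_mul_star_self _
  · conv_lhs => rw [h.1.spectral_theorem, Unitary.conjStarAlgAut_apply]
    rfl

lemma trace_diagonalization {Q : Matrix n n ℂ} (hQ : Qᴴ * Q = 1) (d : n → ℂ) :
    (Q * diagonal d * Qᴴ).trace = ∑ i, d i := by
  rw [trace_mul_comm, ← Matrix.mul_assoc, hQ, Matrix.one_mul, trace_diagonal]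

lemma diagonalization_apply (Q : Matrix n n ℂ) (d : n → ℂ) (i j : n) :
    (Q * diagonal d * Qᴴ) i j = ∑ k, Q i k * d k * star (Q j k) := by
  simp [Matrix.mul_apply, diagonal_apply]

lemma Matrix.PosSemidef.exists_eq_ketbra {M : Matrix n n ℂ} (h : M.PosSemidef)
    (hr : M.rank ≤ 1) : ∃ v : n → ℂ, M = ketbra v v := by
  have hsub : Subsingleton {i // h.1.eigenvalues i ≠ 0} := by
    rw [← Fintype.card_le_one_iff_subsingleton, ← h.1.rank_eq_card_non_zero_eigs]
    exact hr
  set Q : Matrix n n ℂ := (h.1.eigenvectorUnitary : Matrix n n ℂ)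
  set d := h.1.eigenvalues with hd
  have hM : M = Q * diagonal (fun i => (d i : ℂ)) * Qᴴ := by
    conv_lhs => rw [h.1.spectral_theorem, Unitary.conjStarAlgAut_apply]
    rfl
  refine ⟨fun i => ∑ k, (Real.sqrt (d k) : ℂ) * Q i k, ?_⟩
  ext i j
  conv_lhs => rw [hM, diagonalization_apply]
  rw [ketbra, star_sum, Finset.sum_mul_sum]
  refine Finset.sum_congr rfl fun k _ => ?_
  rw [Finset.sum_eq_single k]
  · have : (d k : ℂ) = (Real.sqrt (d k) : ℂ) * (Real.sqrt (d k) : ℂ) := by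
      rw [← Complex.ofReal_mul, Real.mul_self_sqrt (h.eigenvalues_nonneg k)]
    rw [this]
    simp only [star_mul', Complex.star_def, Complex.conj_ofReal]
    ring
  · intro l _ hlk
    by_cases hk : d k = 0
    · simp [hk]
    · by_cases hl : d l = 0
      · simp [hl]
      · exact absurd (congrArg Subtype.val (Subsingleton.elim
          (⟨l, hl⟩ : {i // h.1.eigenvalues i ≠ 0}) ⟨k, hk⟩)) hlk
  · simp

/-- A commuting family of Hermitian matrices has an orthonormal basis of joint eigenvectors. -/
lemma exists_joint_eigenbasis {ι : Type*} (T : ι → Matrix n n ℂ)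
    (hT : ∀ i, (T i).IsHermitian) (hC : ∀ i j, T i * T j = T j * T i) :
    ∃ v : n → n → ℂ, OrthoFam v ∧ ∀ i k, ∃ μ : ℂ, T i *ᵥ v k = μ • v k := by
  classical
  set S : ι → Module.End ℂ (EuclideanSpace ℂ n) := fun i => toEuclideanLin (T i) with hS
  have hsymm : ∀ i, (S i).IsSymmetric := fun i => isSymmetric_toEuclideanLin_iff.mpr (hT i)
  have hcomm : Pairwise (Function.onFun Commute S) := by
    intro i j _
    refine LinearMap.ext fun x => ?_
    simp only [hS, Module.End.mul_apply, toLpLin_apply, mulVec_mulVec, hC i j]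
  set V : (ι → ℂ) → Submodule ℂ (EuclideanSpace ℂ n) :=
    fun α => ⨅ j, Module.End.eigenspace (S j) (α j) with hV
  have hint := LinearMap.IsSymmetric.directSum_isInternal_of_pairwise_commute hsymm hcomm
  have hfin : Finite {α // V α ≠ ⊥} :=
    (WellFoundedGT.finite_ne_bot_of_iSupIndep hint.submodule_iSupIndep).to_subtype
  have := Fintype.ofFinite {α // V α ≠ ⊥}
  have hint' := DirectSum.isInternal_ne_bot_iff.mpr hint
  have horth : OrthogonalFamily ℂ (fun α : {α // V α ≠ ⊥} => V α) fun α => (V α).subtypeₗᵢ :=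
    (LinearMap.IsSymmetric.orthogonalFamily_iInf_eigenspaces hsymm).comp Subtype.val_injective
  have hrank : Module.finrank ℂ (EuclideanSpace ℂ n) = Fintype.card n := finrank_euclideanSpace
  let b := hint'.subordinateOrthonormalBasis hrank horth
  let e := Fintype.equivFin n
  refine ⟨fun k => (b (e k)).ofLp, ?_, ?_⟩
  · intro j k
    have h := orthonormal_iff_ite.mp b.orthonormal (e j) (e k)
    rw [EuclideanSpace.inner_eq_star_dotProduct] at h
    simp only [e.injective.eq_iff] at h
    rw [← h, dotProduct]
    exact Finset.sum_congr rfl fun i _ => mul_comm _ _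
  · intro i k
    have hmem := hint'.subordinateOrthonormalBasis_subordinate hrank (e k) horth
    have hmem' := (Submodule.mem_iInf _).mp hmem i
    rw [Module.End.mem_eigenspace_iff] at hmem'
    exact ⟨_, congrArg WithLp.ofLp hmem'⟩

lemma OrthoFam.sum_mul_star {v : n → n → ℂ} (hv : OrthoFam v) (i j : n) :
    ∑ k, v k i * star (v k j) = if i = j then 1 else 0 := by
  have h1 : (of v).map star * (of v)ᵀ = 1 := by
    ext j k
    simpa [Matrix.mul_apply, one_apply] using hv j k
  have h2 : (of v)ᵀ * (of v).map star = 1 := mul_eq_one_comm.mp h1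
  simpa [Matrix.mul_apply, one_apply] using congrFun (congrFun h2 i) j

end Spectral

section LocalGap

variable {A B X : Type} [Fintype A] [Fintype B] [Fintype X]

/-- The `A`-operator obtained from `ρ` by contracting the `B` row index with `u`, at column `b`. -/
def rowContract (ρ : Matrix (A × B) (A × B) ℂ) (u : B → ℂ) (b : B) : Matrix A A ℂ :=
  fun a a' => ∑ b', star (u b') * ρ (a, b') (a', b)

lemma trace_ptrB (ρ : Matrix (A × B) (A × B) ℂ) : (ptrB ρ).trace = ρ.trace := by
  simp only [trace, diag, ptrB, Fintype.sum_prod_type]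

variable [DecidableEq A]

lemma ptrB_one_kronecker_ketbra_mul (ρ : Matrix (A × B) (A × B) ℂ) (v : B → ℂ) :
    ptrB ((1 : Matrix A A ℂ) ⊗ₖ ketbra v v * ρ) = bContract ρ v v := by
  ext a a'
  simp only [ptrB, bContract, Matrix.mul_apply, Fintype.sum_prod_type, kronecker_apply, one_apply,
    ite_mul, one_mul, zero_mul, ketbra]
  rw [Finset.sum_comm]
  rw [Finset.sum_eq_single a]
  · rw [Finset.sum_comm]
    simp only [if_true]
    exact Finset.sum_congr rfl fun b _ => Finset.sum_congr rfl fun b' _ => by ring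
  · intro c _ hc
    simp [Ne.symm hc]
  · simp

lemma pOf_ketbra (ρ : Matrix (A × B) (A × B) ℂ) (v : B → ℂ) :
    pOf ρ (ketbra v v) = (bContract ρ v v).trace.re := by
  rw [pOf, ← trace_ptrB, ptrB_one_kronecker_ketbra_mul]

lemma sum_norm_sq_conj_unitary {W : Matrix A A ℂ} (hW : W * Wᴴ = 1) (M : Matrix A A ℂ) :
    ∑ a, ∑ a', ‖(Wᴴ * M * W) a a'‖ ^ 2 = ∑ a, ∑ a', ‖M a a'‖ ^ 2 := by
  have key : ∀ M : Matrix A A ℂ, ((∑ a, ∑ a', ‖M a a'‖ ^ 2 : ℝ) : ℂ) = (Mᴴ * M).trace := by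
    intro M
    rw [Finset.sum_comm]
    push_cast
    simp only [trace, diag, Matrix.mul_apply, conjTranspose_apply]
    refine Finset.sum_congr rfl fun a _ => Finset.sum_congr rfl fun a' _ => ?_
    have := ofReal_norm_sq (M a' a)
    push_cast at this
    exact this
  apply Complex.ofReal_injective
  rw [key, key]
  have : (Wᴴ * M * W)ᴴ * (Wᴴ * M * W) = Wᴴ * (Mᴴ * M * W) := by
    simp only [conjTranspose_mul, conjTranspose_conjTranspose, Matrix.mul_assoc]
    rw [← Matrix.mul_assoc W Wᴴ, hW, Matrix.one_mul]
  rw [this, trace_mul_comm, Matrix.mul_assoc, hW, Matrix.mul_one]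

variable [DecidableEq B] [DecidableEq X]

lemma condState_ketbra (ρ : Matrix (A × B) (A × B) ℂ) (v : B → ℂ) :
    condState ρ (ketbra v v) =
      (((bContract ρ v v).trace.re : ℝ) : ℂ)⁻¹ • bContract ρ v v := by
  rw [condState, ptrB_one_kronecker_ketbra_mul, pOf_ketbra]

/-- The contribution of a single measurement vector `v`: the weights of `v` in the product of the
spectra of `ρ` and of the conditional state, together with the resolvent comparison they satisfy. -/
lemma measurement_vector_gap (ρ : Matrix (A × B) (A × B) ℂ) (hρ : (ptrA ρ).IsHermitian)
    (L : A → B → X → ℂ) (r : X → ℝ)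
    (hLρ : ∀ a b a' b', ∑ x, L a b x * star (L a' b' x) = ρ (a, b) (a', b'))
    (hL : ∀ x x', ∑ a, ∑ b, star (L a b x) * L a b x' = if x = x' then (r x : ℂ) else 0)
    (hr : ∀ x, 0 ≤ r x) (hr1 : ∀ x, r x ≤ 1) (v : B → ℂ) :
    ∃ (s : A → ℝ) (κ : A → X → ℝ), (∀ a, 0 ≤ s a) ∧
      (∀ a x, κ a x ≠ 0 → 0 < s a ∧ 0 < r x) ∧
      (∀ a, ∑ x, κ a x = pOf ρ (ketbra v v) * s a) ∧
      vNEntropy (condState ρ (ketbra v v)) = ∑ a, Real.negMulLog (s a) ∧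
      (∀ x, ((∑ a, κ a x : ℝ) : ℂ) =
        ∑ a, ∑ b, ∑ b', star (v b) * v b' * (L a b x * star (L a b' x))) ∧
      ∀ (t : ℝ) (u : B → ℂ), 0 < t → ptrA ρ *ᵥ u + (t : ℂ) • u = v →
        0 ≤ (star v ⬝ᵥ (ptrA ρ *ᵥ u)).re - ∑ a, ∑ x, κ a x * (s a / (r x + t * s a)) ∧
        (1 ≤ t → ∑ a, ∑ a', ∑ b, ‖rowContract ρ u b a a' -
            condState ρ (ketbra v v) a a' * (rowContract ρ u b).trace‖ ^ 2 ≤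
          4 * ((star v ⬝ᵥ (ptrA ρ *ᵥ u)).re - ∑ a, ∑ x, κ a x * (s a / (r x + t * s a)))) := by
  set Lm : B → Matrix A X ℂ := fun b => of fun a x => L a b x with hLm
  have hLmρ : ∀ b b', Lm b * (Lm b')ᴴ = of fun a a' => ρ (a, b) (a', b') := by
    intro b b'
    ext a a'
    simp [hLm, Matrix.mul_apply, ← hLρ]
  have hcomb : ∀ (c : B → ℂ) b', (∑ b, star (c b) • Lm b) * (Lm b')ᴴ = rowContract ρ c b' := by
    intro c b'
    simp only [Matrix.sum_mul, Matrix.smul_mul, hLmρ]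
    ext a a'
    simp [rowContract, Matrix.sum_apply]
  set K₀ : Matrix A X ℂ := ∑ b, star (v b) • Lm b with hK₀
  set τ : Matrix A A ℂ := bContract ρ v v with hτ
  have hτK : τ = K₀ * K₀ᴴ := by
    conv_rhs => rw [hK₀, conjTranspose_sum, Matrix.mul_sum]
    simp only [conjTranspose_smul, star_star, Matrix.mul_smul, hcomb]
    ext a a'
    simp only [hτ, bContract, Matrix.sum_apply, Matrix.smul_apply, rowContract, smul_eq_mul,
      Finset.mul_sum]
    rw [Finset.sum_comm]
    exact Finset.sum_congr rfl fun b _ => Finset.sum_congr rfl fun b' _ => by ring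
  have hτpsd : τ.PosSemidef := hτK ▸ posSemidef_self_mul_conjTranspose K₀
  set q : ℝ := τ.trace.re with hq
  have hqτ : ((q : ℝ) : ℂ) = τ.trace :=
    Complex.ext rfl (Complex.nonneg_iff.mp hτpsd.trace_nonneg).2
  have hq0 : 0 ≤ q := (Complex.nonneg_iff.mp hτpsd.trace_nonneg).1
  have hpq : pOf ρ (ketbra v v) = q := pOf_ketbra ρ v
  set σ := condState ρ (ketbra v v) with hσ
  have hστ : σ = ((q : ℝ) : ℂ)⁻¹ • τ := condState_ketbra ρ v
  have hτσ : τ = ((q : ℝ) : ℂ) • σ := by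
    by_cases h : q = 0
    · have : τ = 0 := hτpsd.trace_eq_zero_iff.mp (by rw [← hqτ, h, Complex.ofReal_zero])
      simp [this, h]
    · rw [hστ, smul_smul, mul_inv_cancel₀ (by exact_mod_cast h), one_smul]
  have hσpsd : σ.PosSemidef := by
    rw [hστ]
    refine hτpsd.smul ?_
    rw [← Complex.ofReal_inv]
    exact_mod_cast inv_nonneg.mpr hq0
  obtain ⟨W, s, hWW, hWW', hσW, hs⟩ := hσpsd.exists_diagonalization
  have hs1 : ∑ a, s a ≤ 1 := by
    have h1 : ((∑ a, s a : ℝ) : ℂ) = ((q⁻¹ * q : ℝ) : ℂ) := by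
      rw [Complex.ofReal_sum, ← trace_diagonalization hWW, ← hσW, hστ, trace_smul, ← hqτ]
      simp
    rw [Complex.ofReal_injective h1]
    by_cases h : q = 0
    · simp [h]
    · rw [inv_mul_cancel₀ h]
  set K : Matrix A X ℂ := Wᴴ * K₀ with hK
  set L' : A → B → X → ℂ := fun a b x => (Wᴴ * Lm b) a x with hL'
  have hcombL' : ∀ (c : B → ℂ) a x,
      (Wᴴ * ∑ b, star (c b) • Lm b) a x = ∑ b, star (c b) * L' a b x := by
    intro c a x
    simp [Matrix.mul_sum, Matrix.sum_apply, hL']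
  have hKK : K * Kᴴ = diagonal fun a => ((q * s a : ℝ) : ℂ) := by
    have h1 : K * Kᴴ = Wᴴ * τ * W := by
      rw [hK, hτK, conjTranspose_mul, conjTranspose_conjTranspose]
      simp only [Matrix.mul_assoc]
    have h2 : Wᴴ * σ * W = diagonal fun a => (s a : ℂ) := by
      conv_lhs => rw [hσW]
      rw [show Wᴴ * (W * diagonal (fun a => (s a : ℂ)) * Wᴴ) * W =
        (Wᴴ * W) * diagonal (fun a => (s a : ℂ)) * (Wᴴ * W) by simp only [Matrix.mul_assoc],
        hWW, Matrix.one_mul, Matrix.mul_one]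
    rw [h1, hτσ, Matrix.mul_smul, Matrix.smul_mul, h2]
    ext a a'
    by_cases h : a = a' <;> simp [h]
  have hKrow : ∀ a, ∑ x, ‖K a x‖ ^ 2 = q * s a := by
    intro a
    apply Complex.ofReal_injective
    have h1 := congrFun (congrFun hKK a) a
    rw [diagonal_apply_eq, Matrix.mul_apply] at h1
    rw [← h1]
    push_cast
    refine Finset.sum_congr rfl fun x _ => ?_
    have := ofReal_norm_sq (K a x)
    push_cast at this
    rw [this, conjTranspose_apply, mul_comm]
  have hKs : ∀ a x, s a = 0 → K a x = 0 := by
    intro a x h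
    have h1 := hKrow a
    rw [h, mul_zero, Finset.sum_eq_zero_iff_of_nonneg fun _ _ => by positivity] at h1
    simpa using h1 x (Finset.mem_univ x)
  have hLzero : ∀ x, r x = 0 → ∀ a b, L a b x = 0 := by
    intro x h a b
    have h1 : ((∑ a, ∑ b, ‖L a b x‖ ^ 2 : ℝ) : ℂ) = 0 := by
      have h2 := hL x x
      rw [if_pos rfl, h, Complex.ofReal_zero] at h2
      rw [← h2]
      push_cast
      refine Finset.sum_congr rfl fun a _ => Finset.sum_congr rfl fun b _ => ?_
      have := ofReal_norm_sq (L a b x)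
      push_cast at this
      exact this
    have h2 : ∑ a, ∑ b, ‖L a b x‖ ^ 2 = 0 := by exact_mod_cast h1
    rw [Finset.sum_eq_zero_iff_of_nonneg fun _ _ => Finset.sum_nonneg fun _ _ => by positivity] at h2
    have h3 := h2 a (Finset.mem_univ a)
    rw [Finset.sum_eq_zero_iff_of_nonneg fun _ _ => by positivity] at h3
    simpa using h3 b (Finset.mem_univ b)
  have hKr : ∀ a x, r x = 0 → K a x = 0 := by
    intro a x h
    simp [hK, hK₀, hLm, Matrix.mul_apply, Matrix.sum_apply, hLzero x h]
  have hL'orth : ∀ x x', ∑ a, ∑ b, star (L' a b x) * L' a b x' =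
      if x = x' then (r x : ℂ) else 0 := by
    intro x x'
    rw [← hL x x', Finset.sum_comm]
    conv_rhs => rw [Finset.sum_comm]
    refine Finset.sum_congr rfl fun b _ => ?_
    have h1 : (Wᴴ * Lm b)ᴴ * (Wᴴ * Lm b) = (Lm b)ᴴ * Lm b := by
      rw [conjTranspose_mul, conjTranspose_conjTranspose, Matrix.mul_assoc,
        ← Matrix.mul_assoc W, hWW', Matrix.one_mul]
    have h2 := congrFun (congrFun h1 x) x'
    rw [Matrix.mul_apply, Matrix.mul_apply] at h2
    exact h2
  refine ⟨s, fun a x => ‖K a x‖ ^ 2, hs, ?_, ?_, vNEntropy_eq_of_diagonalization hWW hσW, ?_, ?_⟩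
  · intro a x h
    refine ⟨lt_of_le_of_ne (hs a) fun h0 => h ?_, lt_of_le_of_ne (hr x) fun h0 => h ?_⟩
    · simp [hKs a x h0.symm]
    · simp [hKr a x h0.symm]
  · intro a
    rw [hpq, hKrow]
  · intro x
    have h1 : Kᴴ * K = K₀ᴴ * K₀ := by
      rw [hK, conjTranspose_mul, conjTranspose_conjTranspose, Matrix.mul_assoc,
        ← Matrix.mul_assoc W, hWW', Matrix.one_mul]
    have h2 := congrFun (congrFun h1 x) x
    have h3 : ((∑ a, ‖K a x‖ ^ 2 : ℝ) : ℂ) = (Kᴴ * K) x x := by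
      rw [Matrix.mul_apply]
      push_cast
      refine Finset.sum_congr rfl fun a _ => ?_
      have := ofReal_norm_sq (K a x)
      push_cast at this
      exact this
    rw [h3, h2, Matrix.mul_apply]
    refine Finset.sum_congr rfl fun a _ => ?_
    have h4 : K₀ a x = ∑ b, star (v b) * L a b x := by simp [hK₀, hLm, Matrix.sum_apply]
    rw [conjTranspose_apply, h4, star_sum, mul_comm, Finset.sum_mul_sum]
    refine Finset.sum_congr rfl fun b _ => Finset.sum_congr rfl fun b' _ => ?_
    simp only [star_mul', star_star]
    ring
  · intro t u ht hu
    set U : Matrix A X ℂ := Wᴴ * ∑ b, star (u b) • Lm b with hU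
    have hUX : ∀ a a' b, contractX L' U a a' b = (Wᴴ * rowContract ρ u b * W) a a' := by
      intro a a' b
      have h1 : U * (Wᴴ * Lm b)ᴴ = Wᴴ * rowContract ρ u b * W := by
        rw [hU, ← hcomb, conjTranspose_mul, conjTranspose_conjTranspose]
        simp only [Matrix.mul_assoc]
      rw [← h1, Matrix.mul_apply]
      rfl
    have hUtr : ∀ b, contractAX L' U b = (rowContract ρ u b).trace := by
      intro b
      have h1 : (Wᴴ * rowContract ρ u b * W).trace = (rowContract ρ u b).trace := by
        rw [trace_mul_comm, ← Matrix.mul_assoc, hWW', Matrix.one_mul]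
      rw [← h1]
      exact Finset.sum_congr rfl fun a _ => hUX a a b
    have hUΛ : ∀ b, contractAX L' U b = star ((ptrA ρ *ᵥ u) b) := by
      intro b
      rw [hUtr, trace, mulVec, dotProduct, star_sum]
      simp only [diag, rowContract]
      rw [Finset.sum_comm]
      refine Finset.sum_congr rfl fun b' _ => ?_
      rw [← Finset.mul_sum, star_mul', hρ.apply b' b, mul_comm]
      rfl
    have hpair : ∀ (c : B → ℂ) (η : A → X → ℂ),
        ∑ a, ∑ x, star (η a x) * ∑ b, star (c b) * L' a b x =
          ∑ b, star (c b) * star (contractAX L' η b) := by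
      intro c η
      simp only [contractAX, contractX, star_sum, star_mul', star_star, Finset.mul_sum]
      conv_rhs => rw [Finset.sum_comm]
      refine Finset.sum_congr rfl fun a _ => ?_
      rw [Finset.sum_comm]
      exact Finset.sum_congr rfl fun b _ => Finset.sum_congr rfl fun x _ => by ring
    have hKe : ∀ a x, K a x = ∑ b, star (v b) * L' a b x := hcombL' v
    have hUe : ∀ a x, U a x = ∑ b, star (u b) * L' a b x := hcombL' u
    have hKU : ∀ η : A → X → ℂ, ∑ a, ∑ x, star (η a x) * K a x =
        ∑ b, star (contractAX L' η b) * contractAX L' U b +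
          t * ∑ a, ∑ x, star (η a x) * U a x := by
      intro η
      simp only [hKe, hUe, hpair]
      rw [Finset.mul_sum, ← Finset.sum_add_distrib]
      refine Finset.sum_congr rfl fun b _ => ?_
      rw [show contractAX L' U b = _ from hUΛ b, ← congrFun hu b]
      simp only [Pi.add_apply, Pi.smul_apply, smul_eq_mul, star_add, star_mul', Complex.star_def,
        Complex.conj_ofReal]
      ring
    have hUK : ∑ a, ∑ x, star (U a x) * K a x = star v ⬝ᵥ (ptrA ρ *ᵥ u) := by
      simp only [hKe]
      rw [hpair v U, dotProduct]
      refine Finset.sum_congr rfl fun b _ => ?_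
      rw [hUΛ, star_star, Pi.star_apply]
    have hgap := resolvent_gap L' r s t K U hL'orth hr hr1 hs hs1 ht hKs hKU
    rw [hUK] at hgap
    refine ⟨hgap.1, fun ht1 => le_trans (le_of_eq ?_) (hgap.2 ht1)⟩
    have herr : ∀ a a' b, contractX L' U a a' b -
        (if a = a' then (s a : ℂ) * contractAX L' U b else 0) =
        (Wᴴ * (rowContract ρ u b - (rowContract ρ u b).trace • σ) * W) a a' := by
      intro a a' b
      have h2 : Wᴴ * σ * W = diagonal fun a => (s a : ℂ) := by
        conv_lhs => rw [hσW]
        rw [show Wᴴ * (W * diagonal (fun a => (s a : ℂ)) * Wᴴ) * W =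
          (Wᴴ * W) * diagonal (fun a => (s a : ℂ)) * (Wᴴ * W) by simp only [Matrix.mul_assoc],
          hWW, Matrix.one_mul, Matrix.mul_one]
      rw [Matrix.mul_sub, Matrix.sub_mul, Matrix.sub_apply, hUX, Matrix.mul_smul, Matrix.smul_mul,
        h2, hUtr]
      by_cases h : a = a' <;> simp [h, mul_comm]
    simp only [herr]
    have hswap : ∀ f : A → A → B → ℝ, ∑ a, ∑ a', ∑ b, f a a' b = ∑ b, ∑ a, ∑ a', f a a' b := by
      intro f
      rw [Finset.sum_congr rfl fun a _ => Finset.sum_comm, Finset.sum_comm]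
    rw [hswap, hswap]
    refine Finset.sum_congr rfl fun b _ => ?_
    rw [sum_norm_sq_conj_unitary hWW']
    simp only [Matrix.sub_apply, Matrix.smul_apply, smul_eq_mul, mul_comm]

end LocalGap

section GlobalGap

variable {A B : Type} [Fintype A]

lemma ptrA_posSemidef {ρ : Matrix (A × B) (A × B) ℂ} (hρ : ρ.PosSemidef) :
    (ptrA ρ).PosSemidef := by
  have h : ptrA ρ = ∑ a, ρ.submatrix (fun b => (a, b)) (fun b => (a, b)) := by
    ext b b'
    simp [ptrA, Matrix.sum_apply]
  rw [h]
  exact posSemidef_sum _ fun a _ => hρ.submatrix _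

variable [Fintype B]

lemma trace_ptrA (ρ : Matrix (A × B) (A × B) ℂ) : (ptrA ρ).trace = ρ.trace := by
  simp only [trace, diag, ptrA, Fintype.sum_prod_type]
  exact Finset.sum_comm

variable [DecidableEq B]

/-- The matrix `(Λ + t)⁻¹` for `Λ = Q diag(lam) Qᴴ`. -/
def resolventOf (Q : Matrix B B ℂ) (lam : B → ℝ) (t : ℝ) : Matrix B B ℂ :=
  Q * diagonal (fun j => (((lam j + t)⁻¹ : ℝ) : ℂ)) * Qᴴ

lemma diagonalization_mul {Q : Matrix B B ℂ} (hQ : Qᴴ * Q = 1) (d e : B → ℂ) :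
    Q * diagonal d * Qᴴ * (Q * diagonal e * Qᴴ) = Q * diagonal (fun j => d j * e j) * Qᴴ := by
  rw [show Q * diagonal d * Qᴴ * (Q * diagonal e * Qᴴ) =
    Q * diagonal d * (Qᴴ * Q) * diagonal e * Qᴴ by simp only [Matrix.mul_assoc], hQ,
    Matrix.mul_one, Matrix.mul_assoc Q, diagonal_mul_diagonal]

lemma mul_resolventOf_add {Q : Matrix B B ℂ} {lam : B → ℝ} (hQ : Qᴴ * Q = 1) (hQ' : Q * Qᴴ = 1)
    (hlam : ∀ j, 0 ≤ lam j) {t : ℝ} (ht : 0 < t) :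
    Q * diagonal (fun j => (lam j : ℂ)) * Qᴴ * resolventOf Q lam t +
      (t : ℂ) • resolventOf Q lam t = 1 := by
  rw [resolventOf, diagonalization_mul hQ, ← Matrix.smul_mul, ← Matrix.mul_smul, ← Matrix.add_mul,
    ← Matrix.mul_add, ← diagonal_smul, diagonal_add]
  have : (fun j => (lam j : ℂ) * (((lam j + t)⁻¹ : ℝ) : ℂ) +
      ((t : ℂ) • fun j => (((lam j + t)⁻¹ : ℝ) : ℂ)) j) = 1 := by
    funext j
    have h : lam j + t ≠ 0 := (add_pos_of_nonneg_of_pos (hlam j) ht).ne'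
    simp only [Pi.smul_apply, smul_eq_mul, Pi.one_apply]
    rw [← add_mul]
    exact_mod_cast mul_inv_cancel₀ h
  rw [this, diagonal_one', Matrix.mul_one, hQ']

lemma sum_star_dotProduct_mulVec {m : ℕ} {v : Fin m → B → ℂ} (hv : ∑ i, ketbra (v i) (v i) = 1)
    (M : Matrix B B ℂ) : ∑ i, star (v i) ⬝ᵥ (M *ᵥ v i) = M.trace := by
  have h : ∀ i, star (v i) ⬝ᵥ (M *ᵥ v i) = (M * ketbra (v i) (v i)).trace := by
    intro i
    simp only [dotProduct, mulVec, trace, diag, Matrix.mul_apply, ketbra, Finset.mul_sum,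
      Pi.star_apply]
    exact Finset.sum_congr rfl fun b _ => Finset.sum_congr rfl fun b' _ => by ring
  rw [Finset.sum_congr rfl fun i _ => h i, ← trace_sum, ← Matrix.mul_sum, hv, Matrix.mul_one]

variable [DecidableEq A]

/-- For a rank-one POVM, the discord functional is nonnegative, and it controls the failure of the
conditional operators to factorize. -/
lemma povm_gap {ρ : Matrix (A × B) (A × B) ℂ} (hρ : IsDensity ρ) {Q : Matrix B B ℂ} {lam : B → ℝ}
    (hQ : Qᴴ * Q = 1) (hQ' : Q * Qᴴ = 1) (hΛ : ptrA ρ = Q * diagonal (fun j => (lam j : ℂ)) * Qᴴ)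
    (hlam : ∀ j, 0 ≤ lam j) {m : ℕ} {v : Fin m → B → ℂ} (hv : ∑ i, ketbra (v i) (v i) = 1) :
    0 ≤ vNEntropy (ptrA ρ) - vNEntropy ρ +
        ∑ i, pOf ρ (ketbra (v i) (v i)) * vNEntropy (condState ρ (ketbra (v i) (v i))) ∧
      ∃ ξ ∈ Set.Icc (2 : ℝ) 3, ∑ i, ∑ a, ∑ a', ∑ b,
          ‖rowContract ρ (resolventOf Q lam ξ *ᵥ v i) b a a' -
            condState ρ (ketbra (v i) (v i)) a a' *
              (rowContract ρ (resolventOf Q lam ξ *ᵥ v i) b).trace‖ ^ 2 ≤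
        4 * (vNEntropy (ptrA ρ) - vNEntropy ρ +
          ∑ i, pOf ρ (ketbra (v i) (v i)) * vNEntropy (condState ρ (ketbra (v i) (v i)))) := by
  obtain ⟨E, r, hE, hE', hρE, hr⟩ := hρ.1.exists_diagonalization
  have hrsum : ∑ x, r x = 1 := by
    have h := hρ.2
    rw [hρE, trace_diagonalization hE] at h
    exact_mod_cast h
  have hlamsum : ∑ j, lam j = 1 := by
    have h := hρ.2
    rw [← trace_ptrA, hΛ, trace_diagonalization hQ] at h
    exact_mod_cast h
  have hr1 : ∀ x, r x ≤ 1 := fun x => by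
    rw [← hrsum]
    exact Finset.single_le_sum (fun x _ => hr x) (Finset.mem_univ x)
  set L : A → B → A × B → ℂ := fun a b x => (Real.sqrt (r x) : ℂ) * E (a, b) x with hLdef
  have hsq : ∀ x, (Real.sqrt (r x) : ℂ) * (Real.sqrt (r x) : ℂ) = (r x : ℂ) := fun x => by
    exact_mod_cast Real.mul_self_sqrt (hr x)
  have hLρ : ∀ a b a' b', ∑ x, L a b x * star (L a' b' x) = ρ (a, b) (a', b') := by
    intro a b a' b'
    conv_rhs => rw [hρE, diagonalization_apply]
    refine Finset.sum_congr rfl fun x _ => ?_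
    simp only [hLdef, star_mul', Complex.star_def, Complex.conj_ofReal]
    rw [← hsq x]
    ring
  have hL : ∀ x x', ∑ a, ∑ b, star (L a b x) * L a b x' = if x = x' then (r x : ℂ) else 0 := by
    intro x x'
    have h := congrFun (congrFun hE x) x'
    rw [Matrix.mul_apply, Fintype.sum_prod_type] at h
    have h1 : ∑ a, ∑ b, star (L a b x) * L a b x' =
        (Real.sqrt (r x) : ℂ) * (Real.sqrt (r x') : ℂ) *
          ∑ a, ∑ b, Eᴴ x (a, b) * E (a, b) x' := by
      simp only [Finset.mul_sum]
      refine Finset.sum_congr rfl fun a _ => Finset.sum_congr rfl fun b _ => ?_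
      simp only [hLdef, star_mul', Complex.star_def, Complex.conj_ofReal, conjTranspose_apply]
      ring
    rw [h1, h, one_apply]
    by_cases hx : x = x'
    · simp only [hx, if_true, mul_one, hsq]
    · simp [hx]
  choose s κ hs hκ hκrow hent hκcol hgap using fun i =>
    measurement_vector_gap ρ (ptrA_posSemidef hρ.1).1 L r hLρ hL hr hr1 (v i)
  have hκr : ∀ x, ∑ i, ∑ a, κ i a x = r x := by
    intro x
    apply Complex.ofReal_injective
    rw [Complex.ofReal_sum, Finset.sum_congr rfl fun i _ => hκcol i x]
    have h := hL x x
    rw [if_pos rfl] at h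
    rw [← h, Finset.sum_comm]
    refine Finset.sum_congr rfl fun a _ => ?_
    rw [Finset.sum_comm]
    refine Finset.sum_congr rfl fun b _ => ?_
    rw [Finset.sum_comm]
    have h2 : ∀ b', ∑ i, star (v i b) * v i b' * (L a b x * star (L a b' x)) =
        if b' = b then L a b x * star (L a b' x) else 0 := by
      intro b'
      have h3 := congrFun (congrFun hv b') b
      rw [Matrix.sum_apply, one_apply] at h3
      rw [← Finset.sum_mul, Finset.sum_congr rfl fun i _ => mul_comm (star (v i b)) (v i b')]
      change (∑ i, ketbra (v i) (v i) b' b) * _ = _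
      rw [h3, ite_mul, one_mul, zero_mul]
    rw [Finset.sum_congr rfl fun b' _ => h2 b', Finset.sum_ite_eq' _ b, if_pos (Finset.mem_univ b),
      mul_comm]
  set c : B ⊕ (Fin m × A × (A × B)) → ℝ := Sum.elim lam fun p => -κ p.1 p.2.1 p.2.2 with hc
  set y : B ⊕ (Fin m × A × (A × B)) → ℝ := Sum.elim lam fun p => r p.2.2 / s p.1 p.2.1 with hy
  have hsplit : ∀ f : B ⊕ (Fin m × A × (A × B)) → ℝ, ∑ k, f k =
      ∑ j, f (.inl j) + ∑ i, ∑ a, ∑ x, f (.inr (i, a, x)) := by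
    intro f
    rw [Fintype.sum_sum_type, Fintype.sum_prod_type]
    simp only [Fintype.sum_prod_type (α₁ := A) (α₂ := A × B)]
  have hres : ∀ t : ℝ, 0 < t → ∑ k, c k / (y k + t) =
      ∑ i, ((star (v i) ⬝ᵥ (ptrA ρ *ᵥ (resolventOf Q lam t *ᵥ v i))).re -
        ∑ a, ∑ x, κ i a x * (s i a / (r x + t * s i a))) := by
    intro t ht
    rw [hsplit, Finset.sum_sub_distrib, ← Complex.re_sum, sub_eq_add_neg]
    congr 1
    · simp only [Matrix.mulVec_mulVec]
      rw [sum_star_dotProduct_mulVec hv, hΛ, resolventOf, diagonalization_mul hQ,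
        trace_diagonalization hQ, Complex.re_sum]
      refine Finset.sum_congr rfl fun j _ => ?_
      rw [← Complex.ofReal_mul, Complex.ofReal_re, ← div_eq_mul_inv]
      rfl
    · simp only [← Finset.sum_neg_distrib]
      refine Finset.sum_congr rfl fun i _ => Finset.sum_congr rfl fun a _ =>
        Finset.sum_congr rfl fun x _ => ?_
      simp only [hc, hy, Sum.elim_inr]
      by_cases h : κ i a x = 0
      · simp [h]
      · obtain ⟨h1, h2⟩ := hκ i a x h
        have h3 : r x + t * s i a ≠ 0 := by positivity
        have h4 : r x / s i a + t ≠ 0 := by positivity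
        field_simp
  have hlog : -∑ k, c k * Real.log (y k) = vNEntropy (ptrA ρ) - vNEntropy ρ +
        ∑ i, pOf ρ (ketbra (v i) (v i)) * vNEntropy (condState ρ (ketbra (v i) (v i))) := by
    rw [hsplit, vNEntropy_eq_of_diagonalization hQ hΛ, vNEntropy_eq_of_diagonalization hE hρE]
    have h1 : ∑ i, ∑ a, ∑ x, c (.inr (i, a, x)) * Real.log (y (.inr (i, a, x))) =
        ∑ x, Real.negMulLog (r x) -
          ∑ i, pOf ρ (ketbra (v i) (v i)) * vNEntropy (condState ρ (ketbra (v i) (v i))) := by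
      have h2 : ∀ i a x, c (.inr (i, a, x)) * Real.log (y (.inr (i, a, x))) =
          κ i a x * Real.log (s i a) - κ i a x * Real.log (r x) := by
        intro i a x
        simp only [hc, hy, Sum.elim_inr]
        by_cases h : κ i a x = 0
        · simp [h]
        · obtain ⟨h3, h4⟩ := hκ i a x h
          rw [Real.log_div h4.ne' h3.ne']
          ring
      have h3 : ∑ i, ∑ a, ∑ x, κ i a x * Real.log (s i a) =
          -∑ i, pOf ρ (ketbra (v i) (v i)) * vNEntropy (condState ρ (ketbra (v i) (v i))) := by
        rw [← Finset.sum_neg_distrib]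
        refine Finset.sum_congr rfl fun i _ => ?_
        rw [hent, Finset.mul_sum, ← Finset.sum_neg_distrib]
        refine Finset.sum_congr rfl fun a _ => ?_
        rw [← Finset.sum_mul, hκrow, Real.negMulLog]
        ring
      have h4 : ∑ i, ∑ a, ∑ x, κ i a x * Real.log (r x) = -∑ x, Real.negMulLog (r x) := by
        rw [Finset.sum_congr rfl fun i _ => Finset.sum_comm, Finset.sum_comm,
          ← Finset.sum_neg_distrib]
        refine Finset.sum_congr rfl fun x _ => ?_
        simp only [← Finset.sum_mul]
        rw [hκr, Real.negMulLog]
        ring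
      simp only [h2, Finset.sum_sub_distrib, h3, h4]
      ring
    have h5 : ∑ j, c (.inl j) * Real.log (y (.inl j)) = -∑ j, Real.negMulLog (lam j) := by
      rw [← Finset.sum_neg_distrib]
      refine Finset.sum_congr rfl fun j _ => ?_
      simp only [hc, hy, Sum.elim_inl, Real.negMulLog]
      ring
    rw [h1, h5]
    ring
  have hsol : ∀ t : ℝ, 0 < t → ∀ i, ptrA ρ *ᵥ (resolventOf Q lam t *ᵥ v i) +
      (t : ℂ) • (resolventOf Q lam t *ᵥ v i) = v i := by
    intro t ht i
    rw [Matrix.mulVec_mulVec, ← Matrix.smul_mulVec, ← Matrix.add_mulVec, hΛ,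
      mul_resolventOf_add hQ hQ' hlam ht, Matrix.one_mulVec]
  obtain ⟨hpos, ξ, hξ, hle⟩ := log_combination_bound c y
    (by
      rintro (j | ⟨i, a, x⟩) h
      · exact lt_of_le_of_ne (hlam j) (Ne.symm h)
      · obtain ⟨h1, h2⟩ := hκ i a x fun h0 => h (by simp [hc, h0])
        exact div_pos h2 h1)
    (by
      rw [hsplit]
      simp only [hc, Sum.elim_inl, Sum.elim_inr, Finset.sum_neg_distrib, hlamsum]
      rw [Finset.sum_congr rfl fun i _ => Finset.sum_comm, Finset.sum_comm,
        Finset.sum_congr rfl fun x _ => hκr x, hrsum, add_neg_cancel])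
    (fun t ht => by
      rw [hres t ht]
      exact Finset.sum_nonneg fun i _ => (hgap i t _ ht (hsol t ht i)).1)
  rw [hlog] at hpos hle
  have hξ0 : (0 : ℝ) < ξ := by linarith [hξ.1]
  refine ⟨hpos, ξ, hξ, le_trans ?_ (mul_le_mul_of_nonneg_left hle zero_le_four)⟩
  rw [hres ξ hξ0, Finset.mul_sum]
  exact Finset.sum_le_sum fun i _ => (hgap i ξ _ hξ0 (hsol ξ hξ0 i)).2 (by linarith [hξ.1])

end GlobalGap

section Commutation

variable {A B : Type}

/-- The `B`-block of `ρ` at the `A`-indices `a`, `a'`. -/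
def blockB (ρ : Matrix (A × B) (A × B) ℂ) (a a' : A) : Matrix B B ℂ :=
  fun b b' => ρ (a, b) (a', b')

lemma blockB_conjTranspose {ρ : Matrix (A × B) (A × B) ℂ} (hρ : ρ.IsHermitian) (a a' : A) :
    (blockB ρ a a')ᴴ = blockB ρ a' a := by
  ext b b'
  exact hρ.apply (a', b) (a, b')

lemma mul_ketbra [Fintype B] (M : Matrix B B ℂ) (u v : B → ℂ) :
    M * ketbra u v = ketbra (M *ᵥ u) v := by
  ext b b'
  simp only [Matrix.mul_apply, ketbra, mulVec, dotProduct, Finset.sum_mul, mul_assoc]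

lemma ketbra_conjTranspose (u v : B → ℂ) : (ketbra u v)ᴴ = ketbra v u := by
  ext b b'
  simp [ketbra, mul_comm]

lemma ketbra_mul [Fintype B] (M : Matrix B B ℂ) (u v : B → ℂ) :
    ketbra u v * M = ketbra u (Mᴴ *ᵥ v) := by
  rw [← ketbra_conjTranspose (Mᴴ *ᵥ v), ← mul_ketbra, conjTranspose_mul, conjTranspose_conjTranspose,
    ketbra_conjTranspose]

lemma bContract_isHermitian [Fintype B] {ρ : Matrix (A × B) (A × B) ℂ} (hρ : ρ.IsHermitian)
    (v : B → ℂ) : (bContract ρ v v).IsHermitian := by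
  ext a a'
  simp only [conjTranspose_apply, bContract, star_sum, star_mul', star_star, hρ.apply]
  rw [Finset.sum_comm]
  exact Finset.sum_congr rfl fun b _ => Finset.sum_congr rfl fun b' _ => by ring

lemma condState_isHermitian [Fintype A] [Fintype B] [DecidableEq A] [DecidableEq B]
    {ρ : Matrix (A × B) (A × B) ℂ} (hρ : ρ.IsHermitian) (v : B → ℂ) :
    (condState ρ (ketbra v v)).IsHermitian := by
  rw [condState_ketbra, Matrix.IsHermitian, conjTranspose_smul, bContract_isHermitian hρ v]
  congr 1
  simp

/-- Quantitative symmetry of products of nearly factorized families. -/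
lemma norm_sum_commutator_le [Fintype A] [Fintype B] {m : ℕ} (w : Fin m → A → A → B → ℂ)
    (σ : Fin m → Matrix A A ℂ) (hσ : ∀ i, (σ i).IsHermitian) (τ : Fin m → B → ℂ)
    (a a' c c' : A) (b b' : B) :
    ‖∑ i, (star (w i a' a b) * w i c c' b' - star (w i c' c b) * w i a a' b')‖ ≤
      2 * (2 * (√(∑ i, ∑ a, ∑ a', ∑ b, ‖w i a a' b - σ i a a' * τ i b‖ ^ 2) *
        √(∑ i, ∑ a, ∑ a', ∑ b, ‖w i a a' b‖ ^ 2)) +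
        ∑ i, ∑ a, ∑ a', ∑ b, ‖w i a a' b - σ i a a' * τ i b‖ ^ 2) := by
  set e : Fin m → A → A → B → ℂ := fun i a a' b => w i a a' b - σ i a a' * τ i b with he
  have hle : ∀ (f : Fin m → A → A → B → ℂ) a a' b,
      ∑ i, ‖f i a a' b‖ ^ 2 ≤ ∑ i, ∑ a, ∑ a', ∑ b, ‖f i a a' b‖ ^ 2 := by
    intro f a a' b
    refine Finset.sum_le_sum fun i _ => ?_
    calc ‖f i a a' b‖ ^ 2 ≤ ∑ b, ‖f i a a' b‖ ^ 2 :=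
          Finset.single_le_sum (f := fun b => ‖f i a a' b‖ ^ 2) (fun _ _ => by positivity)
            (Finset.mem_univ b)
      _ ≤ ∑ a', ∑ b, ‖f i a a' b‖ ^ 2 :=
          Finset.single_le_sum (f := fun a' => ∑ b, ‖f i a a' b‖ ^ 2)
            (fun _ _ => by positivity) (Finset.mem_univ a')
      _ ≤ ∑ a, ∑ a', ∑ b, ‖f i a a' b‖ ^ 2 :=
          Finset.single_le_sum (f := fun a => ∑ a', ∑ b, ‖f i a a' b‖ ^ 2)
            (fun _ _ => by positivity) (Finset.mem_univ a)
  have hCS : ∀ (f g : Fin m → A → A → B → ℂ) a a' b c c' b',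
      ∑ i, ‖f i a a' b‖ * ‖g i c c' b'‖ ≤ √(∑ i, ∑ a, ∑ a', ∑ b, ‖f i a a' b‖ ^ 2) *
        √(∑ i, ∑ a, ∑ a', ∑ b, ‖g i a a' b‖ ^ 2) := by
    intro f g a a' b c c' b'
    refine (Real.sum_mul_le_sqrt_mul_sqrt _ _ _).trans ?_
    exact mul_le_mul (Real.sqrt_le_sqrt (hle f a a' b)) (Real.sqrt_le_sqrt (hle g c c' b'))
      (Real.sqrt_nonneg _) (Real.sqrt_nonneg _)
  have hEE : ∀ a a' b c c' b', ∑ i, ‖e i a a' b‖ * ‖e i c c' b'‖ ≤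
      ∑ i, ∑ a, ∑ a', ∑ b, ‖e i a a' b‖ ^ 2 := by
    intro a a' b c c' b'
    refine (hCS e e a a' b c c' b').trans_eq (Real.mul_self_sqrt (by positivity))
  have hterm : ∀ i, ‖star (w i a' a b) * w i c c' b' - star (w i c' c b) * w i a a' b'‖ ≤
      (‖e i a' a b‖ * ‖w i c c' b'‖ + ‖e i c c' b'‖ * ‖w i a' a b‖ +
        ‖e i a' a b‖ * ‖e i c c' b'‖) +
      (‖e i c' c b‖ * ‖w i a a' b'‖ + ‖e i a a' b'‖ * ‖w i c' c b‖ +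
        ‖e i c' c b‖ * ‖e i a a' b'‖) := by
    intro i
    have hsplit : star (w i a' a b) * w i c c' b' - star (w i c' c b) * w i a a' b' =
        (star (e i a' a b) * w i c c' b' + star (w i a' a b) * e i c c' b' -
          star (e i a' a b) * e i c c' b') -
        (star (e i c' c b) * w i a a' b' + star (w i c' c b) * e i a a' b' -
          star (e i c' c b) * e i a a' b') := by
      simp only [he, star_sub, star_mul', (hσ i).apply]
      ring
    rw [hsplit]
    have hb : ∀ x y z : ℂ, ∀ t : ℂ, ‖star x * y + star z * t - star x * t‖ ≤
        ‖x‖ * ‖y‖ + ‖t‖ * ‖z‖ + ‖x‖ * ‖t‖ := by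
      intro x y z t
      refine (norm_sub_le _ _).trans (add_le_add ((norm_add_le _ _).trans_eq ?_) (le_of_eq ?_)) <;>
        simp [mul_comm]
    exact (norm_sub_le _ _).trans (add_le_add (hb _ _ _ _) (hb _ _ _ _))
  refine (norm_sum_le _ _).trans ((Finset.sum_le_sum fun i _ => hterm i).trans ?_)
  simp only [Finset.sum_add_distrib]
  linarith [hCS e w a' a b c c' b', hCS e w c c' b' a' a b, hEE a' a b c c' b',
    hCS e w c' c b a a' b', hCS e w a a' b' c' c b, hEE c' c b a a' b']

variable [Fintype B] [DecidableEq B]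

lemma sum_star_rowContract_mul {ρ : Matrix (A × B) (A × B) ℂ} (hρ : ρ.IsHermitian) {m : ℕ}
    {v : Fin m → B → ℂ} (hv : ∑ i, ketbra (v i) (v i) = 1) (N : Matrix B B ℂ)
    (a a' c c' : A) (b b' : B) :
    ∑ i, star (rowContract ρ (N *ᵥ v i) b a' a) * rowContract ρ (N *ᵥ v i) b' c c' =
      (blockB ρ a a' * (N * Nᴴ) * blockB ρ c c') b b' := by
  have h1 : N * Nᴴ = ∑ i, ketbra (N *ᵥ v i) (N *ᵥ v i) := by
    rw [show N * Nᴴ = N * 1 * Nᴴ by rw [Matrix.mul_one], ← hv, Matrix.mul_sum, Matrix.sum_mul]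
    refine Finset.sum_congr rfl fun i _ => ?_
    rw [mul_ketbra, ketbra_mul, conjTranspose_conjTranspose]
  rw [h1, Matrix.mul_sum, Matrix.sum_mul, Matrix.sum_apply]
  refine Finset.sum_congr rfl fun i _ => ?_
  rw [mul_ketbra, ketbra_mul, blockB_conjTranspose hρ]
  simp only [ketbra, rowContract, mulVec, dotProduct, star_sum, star_mul', star_star, blockB,
    hρ.apply]
  congr 1
  · exact Finset.sum_congr rfl fun _ _ => mul_comm _ _
  · exact Finset.sum_congr rfl fun _ _ => mul_comm _ _

variable [Fintype A]

/-- If rank-one POVMs make the discord functional arbitrarily small, then the blocks of `ρ` commute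
through the square of a resolvent of the marginal. -/
lemma exists_resolvent_commutation [DecidableEq A] {ρ : Matrix (A × B) (A × B) ℂ} (hρ : IsDensity ρ)
    {Q : Matrix B B ℂ} {lam : B → ℝ} (hQ : Qᴴ * Q = 1) (hQ' : Q * Qᴴ = 1)
    (hΛ : ptrA ρ = Q * diagonal (fun j => (lam j : ℂ)) * Qᴴ) (hlam : ∀ j, 0 ≤ lam j)
    (hinf : ∀ η > 0, ∃ (m : ℕ) (v : Fin m → B → ℂ), ∑ i, ketbra (v i) (v i) = 1 ∧
      vNEntropy (ptrA ρ) - vNEntropy ρ +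
        ∑ i, pOf ρ (ketbra (v i) (v i)) * vNEntropy (condState ρ (ketbra (v i) (v i))) < η) :
    ∃ ξ ∈ Set.Icc (2 : ℝ) 3, ∀ a a' c c',
      blockB ρ a a' * (resolventOf Q lam ξ * (resolventOf Q lam ξ)ᴴ) * blockB ρ c c' =
        blockB ρ c c' * (resolventOf Q lam ξ * (resolventOf Q lam ξ)ᴴ) * blockB ρ a a' := by
  set S : Set.Icc (2 : ℝ) 3 → Matrix B B ℂ :=
    fun ξ => resolventOf Q lam ξ * (resolventOf Q lam ξ)ᴴ with hS
  have hres : Continuous fun ξ : Set.Icc (2 : ℝ) 3 => resolventOf Q lam ξ := by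
    refine (continuous_const.matrix_mul (Continuous.matrix_diagonal
      (continuous_pi fun j => Complex.continuous_ofReal.comp ?_))).matrix_mul continuous_const
    refine (continuous_const.add continuous_subtype_val).inv₀ fun ξ => ?_
    have := ξ.2.1
    have := hlam j
    change lam j + (ξ : ℝ) ≠ 0
    linarith
  have hScont : Continuous S := hres.matrix_mul hres.matrix_conjTranspose
  have hblock : ∀ a a' c c' b b', Continuous fun ξ =>
      (blockB ρ a a' * S ξ * blockB ρ c c') b b' := fun a a' c c' b b' =>
    ((continuous_const.matrix_mul hScont).matrix_mul continuous_const).matrix_elem b b'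
  set f : A × A × A × A × B × B → Set.Icc (2 : ℝ) 3 → ℝ := fun p ξ =>
    ‖(blockB ρ p.1 p.2.1 * S ξ * blockB ρ p.2.2.1 p.2.2.2.1) p.2.2.2.2.1 p.2.2.2.2.2 -
      (blockB ρ p.2.2.1 p.2.2.2.1 * S ξ * blockB ρ p.1 p.2.1) p.2.2.2.2.1 p.2.2.2.2.2‖ with hf
  have hFcont : Continuous fun ξ => ∑ p, f p ξ :=
    continuous_finsetSum _ fun p _ => ((hblock _ _ _ _ _ _).sub (hblock _ _ _ _ _ _)).norm
  set G : Set.Icc (2 : ℝ) 3 → ℝ := fun ξ =>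
    ∑ a, ∑ a', ∑ b, ((blockB ρ a' a * S ξ * blockB ρ a a') b b).re with hG
  have hGcont : Continuous G := by
    refine continuous_finsetSum _ fun a _ => continuous_finsetSum _ fun a' _ =>
      continuous_finsetSum _ fun b _ => ?_
    exact Complex.continuous_re.comp (hblock a' a a a' b b)
  have hne : (Set.univ : Set (Set.Icc (2 : ℝ) 3)).Nonempty := ⟨⟨2, by norm_num⟩, trivial⟩
  obtain ⟨ξ₀, -, hmin⟩ := isCompact_univ.exists_isMinOn hne hFcont.continuousOn
  obtain ⟨ξ₁, -, hmax⟩ := isCompact_univ.exists_isMaxOn hne hGcont.continuousOn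
  have hbound : ∀ η > 0, ∑ p, f p ξ₀ ≤
      ∑ _p : A × A × A × A × B × B, 2 * (2 * (√(4 * η) * √(G ξ₁)) + 4 * η) := by
    intro η hη
    obtain ⟨m, v, hv, hgap⟩ := hinf η hη
    obtain ⟨-, ξ, hξ, hle⟩ := povm_gap hρ hQ hQ' hΛ hlam hv
    refine (hmin (Set.mem_univ ⟨ξ, hξ⟩)).trans ?_
    have hW : ∑ i, ∑ a, ∑ a', ∑ b, ‖rowContract ρ (resolventOf Q lam ξ *ᵥ v i) b a a'‖ ^ 2 =
        G ⟨ξ, hξ⟩ := by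
      rw [Finset.sum_comm]
      refine Finset.sum_congr rfl fun a _ => ?_
      rw [Finset.sum_comm]
      refine Finset.sum_congr rfl fun a' _ => ?_
      rw [Finset.sum_comm]
      refine Finset.sum_congr rfl fun b _ => ?_
      rw [hS, ← sum_star_rowContract_mul hρ.1.1 hv, Complex.re_sum]
      refine Finset.sum_congr rfl fun i _ => ?_
      rw [← ofReal_norm_sq, Complex.ofReal_re]
    refine Finset.sum_le_sum fun p _ => ?_
    obtain ⟨a, a', c, c', b, b'⟩ := p
    simp only [hf]
    rw [← sum_star_rowContract_mul hρ.1.1 hv, ← sum_star_rowContract_mul hρ.1.1 hv,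
      ← Finset.sum_sub_distrib]
    refine (norm_sum_commutator_le
      (fun i a a' b => rowContract ρ (resolventOf Q lam ξ *ᵥ v i) b a a')
      (fun i => condState ρ (ketbra (v i) (v i))) (fun i => condState_isHermitian hρ.1.1 (v i))
      (fun i b => (rowContract ρ (resolventOf Q lam ξ *ᵥ v i) b).trace) a a' c c' b b').trans ?_
    have hE := hle.trans (mul_le_mul_of_nonneg_left hgap.le zero_le_four)
    rw [hW]
    have hG1 : G ⟨ξ, hξ⟩ ≤ G ξ₁ := hmax (Set.mem_univ _)
    have hprod := mul_le_mul (Real.sqrt_le_sqrt hE) (Real.sqrt_le_sqrt hG1) (Real.sqrt_nonneg _)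
      (Real.sqrt_nonneg _)
    linarith
  have hzero : ∑ p, f p ξ₀ ≤ 0 := by
    have hlim : Filter.Tendsto (fun η : ℝ => ∑ _p : A × A × A × A × B × B,
        2 * (2 * (√(4 * η) * √(G ξ₁)) + 4 * η)) (nhdsWithin 0 (Set.Ioi 0)) (nhds 0) := by
      refine Filter.Tendsto.mono_left ?_ nhdsWithin_le_nhds
      exact Continuous.tendsto' (by fun_prop) _ _ (by simp)
    exact ge_of_tendsto hlim (Filter.eventually_of_mem self_mem_nhdsWithin hbound)
  refine ⟨ξ₀, ξ₀.2, fun a a' c c' => ?_⟩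
  ext b b'
  have hle := (Finset.single_le_sum (f := fun p => f p ξ₀) (fun _ _ => norm_nonneg _)
    (Finset.mem_univ (a, a', c, c', b, b'))).trans hzero
  exact sub_eq_zero.mp (norm_le_zero_iff.mp hle)

/-- Commutation through the square of a resolvent at `ξ ≥ 2` forces the blocks to commute. -/
lemma blockB_commute_of_resolvent_commutation {ρ : Matrix (A × B) (A × B) ℂ}
    {Q : Matrix B B ℂ} {lam : B → ℝ} (hQ : Qᴴ * Q = 1) (hQ' : Q * Qᴴ = 1)
    (hΛ : ptrA ρ = Q * diagonal (fun j => (lam j : ℂ)) * Qᴴ) (hlam : ∀ j, 0 ≤ lam j)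
    (hlam1 : ∀ j, lam j ≤ 1) {ξ : ℝ} (hξ : 2 ≤ ξ)
    (hcomm : ∀ a a' c c',
      blockB ρ a a' * (resolventOf Q lam ξ * (resolventOf Q lam ξ)ᴴ) * blockB ρ c c' =
        blockB ρ c c' * (resolventOf Q lam ξ * (resolventOf Q lam ξ)ᴴ) * blockB ρ a a')
    (a a' c c' : A) : blockB ρ a a' * blockB ρ c c' = blockB ρ c c' * blockB ρ a a' := by
  have hpos : ∀ j, 0 < lam j + ξ := fun j => by linarith [hlam j]
  set g : B → ℂ := fun j => ((((lam j + ξ) ^ 2)⁻¹ : ℝ) : ℂ) with hg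
  have hS : resolventOf Q lam ξ * (resolventOf Q lam ξ)ᴴ = Q * diagonal g * Qᴴ := by
    have h : (resolventOf Q lam ξ)ᴴ = resolventOf Q lam ξ := by
      rw [resolventOf, conjTranspose_mul, conjTranspose_mul, conjTranspose_conjTranspose,
        diagonal_conjTranspose, Matrix.mul_assoc]
      congr 3
      funext j
      simp
    rw [h, resolventOf, diagonalization_mul hQ]
    congr 3
    funext j
    simp only [hg]
    rw [← Complex.ofReal_mul, ← mul_inv, ← sq]
  set S := resolventOf Q lam ξ * (resolventOf Q lam ξ)ᴴ with hSdef
  have hptr : ptrA ρ = ∑ a, blockB ρ a a := by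
    ext b b'
    simp [ptrA, blockB, Matrix.sum_apply]
  have hΛS : ∀ c c', ptrA ρ * S * blockB ρ c c' = blockB ρ c c' * S * ptrA ρ := by
    intro c c'
    rw [hptr, Matrix.sum_mul, Matrix.sum_mul, Matrix.mul_sum]
    exact Finset.sum_congr rfl fun a _ => hcomm a a c c'
  have hSR : ∀ c c', S * blockB ρ c c' = blockB ρ c c' * S := by
    intro c c'
    set R := blockB ρ c c'
    set T := Qᴴ * R * Q with hT
    have hRT : R = Q * T * Qᴴ := by
      rw [hT, show Q * (Qᴴ * R * Q) * Qᴴ = (Q * Qᴴ) * R * (Q * Qᴴ) by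
        simp only [Matrix.mul_assoc], hQ', Matrix.one_mul, Matrix.mul_one]
    have hleft : ∀ d : B → ℂ, Qᴴ * (Q * diagonal d * Qᴴ * R) * Q = diagonal d * T := by
      intro d
      rw [show Qᴴ * (Q * diagonal d * Qᴴ * R) * Q = (Qᴴ * Q) * diagonal d * (Qᴴ * R * Q) by
        simp only [Matrix.mul_assoc], hQ, Matrix.one_mul]
    have hright : ∀ d : B → ℂ, Qᴴ * (R * (Q * diagonal d * Qᴴ)) * Q = T * diagonal d := by
      intro d
      rw [show Qᴴ * (R * (Q * diagonal d * Qᴴ)) * Q = (Qᴴ * R * Q) * diagonal d * (Qᴴ * Q) by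
        simp only [Matrix.mul_assoc], hQ, Matrix.mul_one]
    have hTd : diagonal (fun j => (lam j : ℂ) * g j) * T =
        T * diagonal (fun j => g j * (lam j : ℂ)) := by
      rw [← hleft, ← hright, ← diagonalization_mul hQ, ← diagonalization_mul hQ, ← hS, ← hΛ,
        ← Matrix.mul_assoc R, hΛS]
    have hTg : diagonal g * T = T * diagonal g := by
      ext j k
      rw [diagonal_mul, mul_diagonal]
      have h := congrFun (congrFun hTd j) k
      rw [diagonal_mul, mul_diagonal] at h
      by_cases hjk : T j k = 0
      · simp [hjk]
      · have h1 : (lam j : ℂ) * g j = g k * lam k := by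
          rw [mul_comm (T j k)] at h
          exact mul_right_cancel₀ hjk h
        have h2 : lam j * ((lam j + ξ) ^ 2)⁻¹ = ((lam k + ξ) ^ 2)⁻¹ * lam k := by
          simp only [hg] at h1
          exact_mod_cast h1
        have h3 : lam j * (lam k + ξ) ^ 2 = lam k * (lam j + ξ) ^ 2 := by
          have hj := (hpos j).ne'
          have hk := (hpos k).ne'
          field_simp at h2
          linarith
        have h4 : (lam j - lam k) * (ξ ^ 2 - lam j * lam k) = 0 := by linear_combination h3
        have h5 : lam j = lam k := by
          rcases mul_eq_zero.mp h4 with h | h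
          · linarith
          · nlinarith [hlam j, hlam k, hlam1 j, hlam1 k]
        simp only [hg, h5]
        ring
    rw [hS, hRT]
    rw [show Q * diagonal g * Qᴴ * (Q * T * Qᴴ) = Q * diagonal g * (Qᴴ * Q) * T * Qᴴ by
        simp only [Matrix.mul_assoc],
      show Q * T * Qᴴ * (Q * diagonal g * Qᴴ) = Q * T * (Qᴴ * Q) * diagonal g * Qᴴ by
        simp only [Matrix.mul_assoc], hQ, Matrix.mul_one, Matrix.mul_one, Matrix.mul_assoc Q,
      Matrix.mul_assoc Q T, hTg]
  have hinv : Q * diagonal (fun j => (((lam j + ξ) ^ 2 : ℝ) : ℂ)) * Qᴴ * S = 1 := by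
    rw [hS, diagonalization_mul hQ]
    have : (fun j => (((lam j + ξ) ^ 2 : ℝ) : ℂ) * g j) = 1 := by
      funext j
      have := (hpos j).ne'
      simp only [hg, Pi.one_apply]
      exact_mod_cast mul_inv_cancel₀ (pow_ne_zero 2 this)
    rw [this, diagonal_one', Matrix.mul_one, hQ']
  have hprod : S * (blockB ρ a a' * blockB ρ c c') = S * (blockB ρ c c' * blockB ρ a a') := by
    rw [← Matrix.mul_assoc, hSR, hcomm, ← hSR, Matrix.mul_assoc]
  have := congrArg (fun M => Q * diagonal (fun j => (((lam j + ξ) ^ 2 : ℝ) : ℂ)) * Qᴴ * M) hprod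
  simpa only [← Matrix.mul_assoc, hinv, Matrix.one_mul] using this

end Commutation

section ZeroDiscord

variable {A B : Type}

lemma blockB_sum {ι : Type*} (s : Finset ι) (f : ι → Matrix (A × B) (A × B) ℂ) (a a' : A) :
    blockB (∑ i ∈ s, f i) a a' = ∑ i ∈ s, blockB (f i) a a' := by
  ext b b'
  simp only [blockB, Matrix.sum_apply]

variable [Fintype B]

lemma exists_real_eigenvalue {Λ : Matrix B B ℂ} (hΛ : Λ.PosSemidef) {u : B → ℂ} {μ : ℂ}
    (hu : ∑ b, star (u b) * u b = 1) (h : Λ *ᵥ u = μ • u) :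
    ∃ c : ℝ, Λ *ᵥ u = (c : ℂ) • u := by
  have h1 := hΛ.dotProduct_mulVec_nonneg u
  rw [h, dotProduct_smul, show star u ⬝ᵥ u = 1 from hu, smul_eq_mul, mul_one] at h1
  refine ⟨μ.re, ?_⟩
  rw [h, show ((μ.re : ℝ) : ℂ) = μ from Complex.ext rfl (Complex.nonneg_iff.mp h1).2]

lemma blockB_one_kronecker_mul_mul [Fintype A] [DecidableEq A]
    (ρ : Matrix (A × B) (A × B) ℂ) (P P' : Matrix B B ℂ)
    (a a' : A) :
    blockB ((1 : Matrix A A ℂ) ⊗ₖ P * ρ * ((1 : Matrix A A ℂ) ⊗ₖ P')) a a' =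
      P * blockB ρ a a' * P' := by
  ext b b'
  simp only [blockB, Matrix.mul_apply, Fintype.sum_prod_type, kronecker_apply, one_apply,
    ite_mul, mul_ite, one_mul, zero_mul, mul_zero, Finset.sum_ite_irrel, Finset.sum_const_zero,
    Finset.sum_ite_eq, Finset.sum_ite_eq', Finset.mem_univ, if_true]

variable [DecidableEq B]

lemma OrthoFam.sum_ketbra {v : B → B → ℂ} (hv : OrthoFam v) :
    ∑ k, ketbra (v k) (v k) = 1 := by
  ext i j
  rw [Matrix.sum_apply, one_apply]
  exact hv.sum_mul_star i j

lemma exists_eigenbasis_blockB {ρ : Matrix (A × B) (A × B) ℂ} (hρ : ρ.IsHermitian)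
    (hcomm : ∀ a a' c c', blockB ρ a a' * blockB ρ c c' = blockB ρ c c' * blockB ρ a a') :
    ∃ v : B → B → ℂ, OrthoFam v ∧ ∀ a a' k, ∃ μ : ℂ, blockB ρ a a' *ᵥ v k = μ • v k := by
  set T : (A × A) × Bool → Matrix B B ℂ := fun p =>
    if p.2 then Complex.I • (blockB ρ p.1.1 p.1.2 - blockB ρ p.1.2 p.1.1)
    else blockB ρ p.1.1 p.1.2 + blockB ρ p.1.2 p.1.1 with hT
  have hherm : ∀ p, (T p).IsHermitian := by
    rintro ⟨⟨a, a'⟩, _ | _⟩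
    · simp only [hT, Matrix.IsHermitian, Bool.false_eq_true, if_false, conjTranspose_add,
        blockB_conjTranspose hρ]
      exact add_comm _ _
    · simp only [hT, Matrix.IsHermitian, if_true, conjTranspose_smul, conjTranspose_sub,
        blockB_conjTranspose hρ, Complex.star_def, Complex.conj_I, neg_smul, ← smul_neg, neg_sub]
  have hC : ∀ p q, T p * T q = T q * T p := by
    rintro ⟨⟨a, a'⟩, _ | _⟩ ⟨⟨c, c'⟩, _ | _⟩ <;>
    simp only [hT, Bool.false_eq_true, if_false, if_true, Matrix.mul_smul, Matrix.smul_mul,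
      Matrix.mul_add, Matrix.add_mul, Matrix.mul_sub, Matrix.sub_mul, hcomm c, hcomm c',
      smul_add, smul_sub] <;>
    abel
  obtain ⟨v, hv, heig⟩ := exists_joint_eigenbasis T hherm hC
  refine ⟨v, hv, fun a a' k => ?_⟩
  obtain ⟨μ, hμ⟩ := heig ((a, a'), false) k
  obtain ⟨ν, hν⟩ := heig ((a, a'), true) k
  refine ⟨(1 / 2 : ℂ) * (μ - Complex.I * ν), ?_⟩
  have h : blockB ρ a a' =
      (1 / 2 : ℂ) • (T ((a, a'), false) - Complex.I • T ((a, a'), true)) := by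
    simp only [hT, Bool.false_eq_true, if_false, if_true, smul_smul, Complex.I_mul_I]
    ext b b'
    simp only [Matrix.smul_apply, Matrix.sub_apply, Matrix.add_apply, smul_eq_mul]
    ring
  rw [h, Matrix.smul_mulVec, Matrix.sub_mulVec, Matrix.smul_mulVec, hμ, hν]
  funext b
  simp only [Pi.smul_apply, Pi.sub_apply, smul_eq_mul]
  ring

variable [Fintype A] [DecidableEq A]

lemma mem_measuredCondEntropies_of_orthoFam (ρ : Matrix (A × B) (A × B) ℂ) {v : B → B → ℂ}
    (hv : OrthoFam v) :
    ∑ k, pOf ρ (ketbra (v k) (v k)) * vNEntropy (condState ρ (ketbra (v k) (v k))) ∈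
      measuredCondEntropies ρ := by
  refine ⟨Fintype.card B, fun i => ketbra (v ((Fintype.equivFin B).symm i))
    (v ((Fintype.equivFin B).symm i)), fun i => ?_, fun i => ?_, ?_, ?_⟩
  · exact posSemidef_vecMulVec_self_star (v ((Fintype.equivFin B).symm i))
  · exact rank_vecMulVec_le (v ((Fintype.equivFin B).symm i)) _
  · rw [Equiv.sum_comp (Fintype.equivFin B).symm fun k => ketbra (v k) (v k), hv.sum_ketbra]
  · exact (Equiv.sum_comp (Fintype.equivFin B).symm fun k => pOf ρ (ketbra (v k) (v k)) *
      vNEntropy (condState ρ (ketbra (v k) (v k)))).symm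

lemma exists_vectors_of_mem_measuredCondEntropies {ρ : Matrix (A × B) (A × B) ℂ} {x : ℝ}
    (hx : x ∈ measuredCondEntropies ρ) :
    ∃ (m : ℕ) (v : Fin m → B → ℂ), ∑ i, ketbra (v i) (v i) = 1 ∧
      x = ∑ i, pOf ρ (ketbra (v i) (v i)) * vNEntropy (condState ρ (ketbra (v i) (v i))) := by
  obtain ⟨m, M, hM, hrank, hsum, hx⟩ := hx
  choose v hv using fun i => (hM i).exists_eq_ketbra (hrank i)
  simp only [hv] at hsum hx
  exact ⟨m, v, hsum, hx⟩

lemma sub_le_of_mem_measuredCondEntropies {ρ : Matrix (A × B) (A × B) ℂ} (hρ : IsDensity ρ) {x : ℝ}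
    (hx : x ∈ measuredCondEntropies ρ) : vNEntropy ρ - vNEntropy (ptrA ρ) ≤ x := by
  obtain ⟨m, v, hv, rfl⟩ := exists_vectors_of_mem_measuredCondEntropies hx
  obtain ⟨Q, lam, hQ, hQ', hΛ, hlam⟩ := (ptrA_posSemidef hρ.1).exists_diagonalization
  linarith [(povm_gap hρ hQ hQ' hΛ hlam hv).1]

lemma blockB_commute_of_discord_eq_zero {ρ : Matrix (A × B) (A × B) ℂ} (hρ : IsDensity ρ)
    (h : discord ρ = 0) (a a' c c' : A) :
    blockB ρ a a' * blockB ρ c c' = blockB ρ c c' * blockB ρ a a' := by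
  obtain ⟨Q, lam, hQ, hQ', hΛ, hlam⟩ := (ptrA_posSemidef hρ.1).exists_diagonalization
  have hlamsum : ∑ j, lam j = 1 := by
    have h := hρ.2
    rw [← trace_ptrA, hΛ, trace_diagonalization hQ] at h
    exact_mod_cast h
  have hstd : OrthoFam fun k : B => (Pi.single k 1 : B → ℂ) := by
    intro j k
    simp [Pi.single_apply, eq_comm]
  obtain ⟨ξ, hξ, hcomm⟩ := exists_resolvent_commutation hρ hQ hQ' hΛ hlam (by
    intro η hη
    rw [discord] at h
    obtain ⟨x, hx, hlt⟩ := Real.lt_sInf_add_pos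
      ⟨_, mem_measuredCondEntropies_of_orthoFam ρ hstd⟩ hη
    obtain ⟨m, v, hv, rfl⟩ := exists_vectors_of_mem_measuredCondEntropies hx
    exact ⟨m, v, hv, by linarith⟩)
  refine blockB_commute_of_resolvent_commutation hQ hQ' hΛ hlam (fun j => ?_) hξ.1 hcomm a a' c c'
  rw [← hlamsum]
  exact Finset.single_le_sum (fun j _ => hlam j) (Finset.mem_univ j)

lemma eq_sum_projections_of_eigenbasis {ρ : Matrix (A × B) (A × B) ℂ} {v : B → B → ℂ}
    (hv : OrthoFam v) (heig : ∀ a a' k, ∃ μ : ℂ, blockB ρ a a' *ᵥ v k = μ • v k) :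
    ρ = ∑ j, ((1 : Matrix A A ℂ) ⊗ₖ ketbra (v j) (v j)) * ρ *
      ((1 : Matrix A A ℂ) ⊗ₖ ketbra (v j) (v j)) := by
  have hblock : ∀ a a', blockB ρ a a' =
      blockB (∑ j, ((1 : Matrix A A ℂ) ⊗ₖ ketbra (v j) (v j)) * ρ *
        ((1 : Matrix A A ℂ) ⊗ₖ ketbra (v j) (v j))) a a' := by
    intro a a'
    rw [blockB_sum]
    simp only [blockB_one_kronecker_mul_mul]
    conv_lhs => rw [← Matrix.mul_one (blockB ρ a a'), ← hv.sum_ketbra, Matrix.mul_sum]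
    refine Finset.sum_congr rfl fun k _ => ?_
    obtain ⟨μ, hμ⟩ := heig a a' k
    rw [Matrix.mul_assoc, mul_ketbra, hμ, mul_ketbra, Matrix.mulVec_smul]
    congr 2
    funext b
    have h := hv k k
    rw [if_pos rfl] at h
    simp only [mulVec, dotProduct, ketbra, mul_assoc, ← Finset.mul_sum, h, mul_one]
  ext ⟨a, b⟩ ⟨a', b'⟩
  exact congrFun (congrFun (hblock a a') b) b'

/-- Measuring a block-diagonal state in its own block basis attains the lower bound on the measured
conditional entropy. -/
lemma sum_condEntropy_eq_of_eq_sum_projections {ρ : Matrix (A × B) (A × B) ℂ} (hρ : ρ.PosSemidef)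
    {v : B → B → ℂ} (hv : OrthoFam v)
    (hblock : ρ = ∑ j, ((1 : Matrix A A ℂ) ⊗ₖ ketbra (v j) (v j)) * ρ *
      ((1 : Matrix A A ℂ) ⊗ₖ ketbra (v j) (v j))) :
    ∑ k, pOf ρ (ketbra (v k) (v k)) * vNEntropy (condState ρ (ketbra (v k) (v k))) =
      vNEntropy ρ - vNEntropy (ptrA ρ) := by
  set τ : B → Matrix A A ℂ := fun k => bContract ρ (v k) (v k) with hτ
  have hτpsd : ∀ k, (τ k).PosSemidef := by
    intro k
    have h : τ k = (of fun (p : A × B) (a : A) => if p.1 = a then v k p.2 else 0)ᴴ * ρ *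
        (of fun (p : A × B) (a : A) => if p.1 = a then v k p.2 else 0) := by
      ext a a'
      simp only [hτ, bContract, Matrix.mul_apply, conjTranspose_apply, of_apply,
        Fintype.sum_prod_type, apply_ite star, star_zero, ite_mul, zero_mul, mul_ite, mul_zero,
        Finset.sum_ite_irrel, Finset.sum_const_zero, Finset.sum_ite_eq', Finset.mem_univ, if_true,
        Finset.sum_mul]
      exact Finset.sum_comm
    rw [h]
    exact hρ.conjTranspose_mul_mul_same _
  set q : B → ℝ := fun k => (τ k).trace.re with hq
  have hqτ : ∀ k, ((q k : ℝ) : ℂ) = (τ k).trace := fun k =>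
    Complex.ext rfl (Complex.nonneg_iff.mp (hτpsd k).trace_nonneg).2
  have hq0 : ∀ k, 0 ≤ q k := fun k => (Complex.nonneg_iff.mp (hτpsd k).trace_nonneg).1
  set σ : B → Matrix A A ℂ := fun k => condState ρ (ketbra (v k) (v k)) with hσ
  have hστ : ∀ k, σ k = ((q k : ℝ) : ℂ)⁻¹ • τ k := fun k => condState_ketbra ρ (v k)
  have hτσ : ∀ k, τ k = ((q k : ℝ) : ℂ) • σ k := by
    intro k
    by_cases h : q k = 0
    · have : τ k = 0 := (hτpsd k).trace_eq_zero_iff.mp (by rw [← hqτ, h, Complex.ofReal_zero])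
      simp [this, h]
    · rw [hστ, smul_smul, mul_inv_cancel₀ (by exact_mod_cast h), one_smul]
  have hσpsd : ∀ k, (σ k).PosSemidef := by
    intro k
    rw [hστ]
    refine (hτpsd k).smul ?_
    rw [← Complex.ofReal_inv]
    exact_mod_cast inv_nonneg.mpr (hq0 k)
  choose W s hW _ hσW _ using fun k => (hσpsd k).exists_diagonalization
  have hqs : ∀ k, q k * ∑ a, s k a = q k := by
    intro k
    apply Complex.ofReal_injective
    rw [Complex.ofReal_mul, Complex.ofReal_sum, ← trace_diagonalization (hW k), ← hσW,
      ← smul_eq_mul, ← trace_smul, ← hτσ, hqτ]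
  have hentry : ∀ a b a' b', ρ (a, b) (a', b') =
      ∑ k, v k b * τ k a a' * star (v k b') := by
    intro a b a' b'
    change blockB ρ a a' b b' = _
    conv_lhs => rw [hblock, blockB_sum, Matrix.sum_apply]
    refine Finset.sum_congr rfl fun k _ => ?_
    rw [blockB_one_kronecker_mul_mul]
    simp only [Matrix.mul_apply, ketbra, hτ, bContract, blockB, Finset.mul_sum, Finset.sum_mul]
    rw [Finset.sum_comm]
    exact Finset.sum_congr rfl fun _ _ => Finset.sum_congr rfl fun _ _ => by ring
  have hSB : vNEntropy (ptrA ρ) = ∑ k, Real.negMulLog (q k) := by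
    refine vNEntropy_eq_of_diagonalization (Q := of fun b k => v k b) ?_ ?_
    · ext j k
      simpa [Matrix.mul_apply, one_apply] using hv j k
    · ext b b'
      rw [diagonalization_apply]
      simp only [ptrA, hentry, of_apply]
      rw [Finset.sum_comm]
      refine Finset.sum_congr rfl fun k _ => ?_
      rw [← Finset.sum_mul, ← Finset.mul_sum, hqτ]
      rfl
  have hSAB : vNEntropy ρ = ∑ p : A × B, Real.negMulLog (q p.2 * s p.2 p.1) := by
    refine vNEntropy_eq_of_diagonalization
      (Q := of fun (p x : A × B) => W x.2 p.1 x.1 * v x.2 p.2) ?_ ?_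
    · ext ⟨c, j⟩ ⟨c', k⟩
      have h1 : ((of fun (p x : A × B) => W x.2 p.1 x.1 * v x.2 p.2)ᴴ *
          (of fun (p x : A × B) => W x.2 p.1 x.1 * v x.2 p.2)) (c, j) (c', k) =
          ((W j)ᴴ * W k) c c' * ∑ b, star (v j b) * v k b := by
        simp only [Matrix.mul_apply, conjTranspose_apply, of_apply, Fintype.sum_prod_type,
          Finset.sum_mul_sum, star_mul']
        exact Finset.sum_congr rfl fun _ _ => Finset.sum_congr rfl fun _ _ => by ring
      rw [h1, hv j k]
      by_cases hjk : j = k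
      · subst hjk
        simp [hW, one_apply]
      · simp [hjk, one_apply]
    · ext ⟨a, b⟩ ⟨a', b'⟩
      rw [diagonalization_apply, hentry, Fintype.sum_prod_type_right]
      refine Finset.sum_congr rfl fun k _ => ?_
      rw [hτσ, Matrix.smul_apply, hσW, diagonalization_apply, smul_eq_mul]
      simp only [of_apply, Finset.mul_sum, Finset.sum_mul, star_mul', Complex.ofReal_mul]
      exact Finset.sum_congr rfl fun _ _ => by ring
  rw [hSAB, hSB, Fintype.sum_prod_type_right, ← Finset.sum_sub_distrib]
  refine Finset.sum_congr rfl fun k _ => ?_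
  rw [pOf_ketbra, vNEntropy_eq_of_diagonalization (hW k) (hσW k)]
  simp only [Real.negMulLog_mul, Finset.sum_add_distrib, ← Finset.mul_sum, ← Finset.sum_mul]
  have h : (∑ a, s k a) * Real.negMulLog (q k) = Real.negMulLog (q k) := by
    rw [Real.negMulLog]
    linear_combination (-Real.log (q k)) * hqs k
  rw [h]
  ring

end ZeroDiscord

theorem zero_discord_iff_block_diagonal {dA dB : Type} [Fintype dA] [DecidableEq dA] [Fintype dB] [DecidableEq dB]
    (ρ : Matrix (dA × dB) (dA × dB) ℂ) (hρ : IsDensity ρ) :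
    discord ρ = 0 ↔
      ∃ lam : dB → dB → ℂ, OrthoFam lam ∧
        (∀ j, ∃ c : ℝ, (ptrA ρ).mulVec (lam j) = ((c : ℂ)) • lam j) ∧
        ρ = ∑ j, ((1 : Matrix dA dA ℂ) ⊗ₖ ketbra (lam j) (lam j)) * ρ *
              ((1 : Matrix dA dA ℂ) ⊗ₖ ketbra (lam j) (lam j)) := by
  constructor
  · intro h
    obtain ⟨v, hv, heig⟩ := exists_eigenbasis_blockB hρ.1.1 (blockB_commute_of_discord_eq_zero hρ h)
    refine ⟨v, hv, fun j => ?_, eq_sum_projections_of_eigenbasis hv heig⟩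
    choose μ hμ using fun a => heig a a j
    have hptr : ptrA ρ = ∑ a, blockB ρ a a := by
      ext b b'
      simp [ptrA, blockB, Matrix.sum_apply]
    refine exists_real_eigenvalue (μ := ∑ a, μ a) (ptrA_posSemidef hρ.1) (by simpa using hv j j) ?_
    rw [hptr, Matrix.sum_mulVec, Finset.sum_smul]
    exact Finset.sum_congr rfl fun a _ => hμ a
  · rintro ⟨v, hv, -, hblock⟩
    have hmem := mem_measuredCondEntropies_of_orthoFam ρ hv
    rw [sum_condEntropy_eq_of_eq_sum_projections hρ.1 hv hblock] at hmem
    have hleast : IsLeast (measuredCondEntropies ρ) (vNEntropy ρ - vNEntropy (ptrA ρ)) :=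
      ⟨hmem, fun x hx => sub_le_of_mem_measuredCondEntropies hρ hx⟩
    rw [discord, hleast.csInf_eq]
    ring

end
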